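/- arXiv:1009.3676 — 5 statements merged into one kernel-verified Lean document; each statement's English description precedes it below -/
import Mathlib

section
/- Let d ≥ 1, n > d, and let γ_1 > γ_2 ≥ 1 be integers. Set t_1 = d + 1 − γ_1 and t_2 = d + 1 − γ_2. Then λ_{n,d}((γ_1, γ_2)) = Σ_{ν=0}^{min(t_1, t_2, d−γ_1−γ_2)} C(n, ν) · C(n−ν, t_1−ν) · C(n−t_1, t_2−ν), where C(a,b) denotes the binomial coefficient and the sum is empty (both sides equal 0) when d − γ_1 − γ_2 < 0 or t_1 < 0. -/
attribute [local instance] Classical.propDecidable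

/-- Collections of subsets of `{1,…,n}` (modelled as `Fin n`). -/
abbrev Coll (n : ℕ) := Finset (Finset (Fin n))

/-- `codim_d X = d + 1 - |X|`. -/
def codim {n : ℕ} (d : ℕ) (X : Finset (Fin n)) : ℤ := (d : ℤ) + 1 - X.card

/-- `ρ_d T = Σ_{X ∈ T} codim_d X`. -/
def rho {n : ℕ} (d : ℕ) (T : Coll n) : ℤ := ∑ X ∈ T, codim d X

/-- `D_d T = codim_d (T_1 ∩ … ∩ T_l) - ρ_d T` (used when `|T| ≥ 2`). -/
def Dd {n : ℕ} (d : ℕ) (T : Coll n) : ℤ := codim d (T.inf id) - rho d T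

/-- Membership in the lattice `L(n,d)`. -/
def memL (n d : ℕ) (T : Coll n) : Prop :=
  (∀ T' ⊆ T, 2 ≤ T'.card → 0 < Dd d T') ∧ ∀ X ∈ T, X.card ≤ d

/-- The intersection lattice `L(n,d)`. -/
structure L (n d : ℕ) where
  val : Coll n
  mem : memL n d val

namespace L

instance (n d : ℕ) : PartialOrder (L n d) where
  le S T := S = T ∨ (rho d S.val < rho d T.val ∧ ∀ X ∈ S.val, ∃ Y ∈ T.val, Y ⊆ X)
  le_refl S := Or.inl rfl
  le_trans S T U hST hTU := by
    rcases hST with rfl | hST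
    · exact hTU
    · rcases hTU with rfl | hTU
      · exact Or.inr hST
      · refine Or.inr ⟨hST.1.trans hTU.1, fun X hX => ?_⟩
        obtain ⟨Y, hY, hYX⟩ := hST.2 X hX
        obtain ⟨Z, hZ, hZY⟩ := hTU.2 Y hY
        exact ⟨Z, hZ, hZY.trans hYX⟩
  le_antisymm S T hST hTS := by
    rcases hST with rfl | hST
    · rfl
    · rcases hTS with rfl | hTS
      · rfl
      · exact absurd (hST.1.trans hTS.1) (lt_irrefl _)

noncomputable instance (n d : ℕ) : Fintype (L n d) :=
  Fintype.ofInjective (fun T : L n d => T.val)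
    (fun a b h => by cases a; cases b; simpa using h)

end L

/-- The minimum element `∅` of `L(n,d)`. -/
def Lbot (n d : ℕ) : L n d :=
  ⟨∅, by
    constructor
    · intro T' hT' h2
      rw [Finset.subset_empty] at hT'
      subst hT'
      simp at h2
    · intro X hX
      simp at hX⟩

/-- The maximum element `{∅}` of `L(n,d)`. -/
def Ltop (n d : ℕ) : L n d :=
  ⟨{∅}, by
    constructor
    · intro T' hT' h2
      have h1 : T'.card ≤ 1 := (Finset.card_le_card hT').trans_eq (Finset.card_singleton _)
      exact absurd h2 (by omega)
    · intro X hX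
      rw [Finset.mem_singleton] at hX
      subst hX
      simp⟩

/-- The singleton collection `{X}` as an element of `L(n,d)`. -/
def singL (n d : ℕ) (X : Finset (Fin n)) (hX : X.card ≤ d) : L n d :=
  ⟨{X}, by
    constructor
    · intro T' hT' h2
      have h1 : T'.card ≤ 1 := (Finset.card_le_card hT').trans_eq (Finset.card_singleton _)
      exact absurd h2 (by omega)
    · intro Y hY
      rw [Finset.mem_singleton] at hY
      subst hY
      exact hX⟩

/-- The type of `T ∈ L(n,d)`: the multiset of codimensions of its members. -/
def typeOf {n : ℕ} (d : ℕ) (T : L n d) : Multiset ℕ :=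
  T.val.val.map (fun X => d + 1 - X.card)

/-- `λ_{n,d}(γ)`: the number of elements of `L(n,d)` of type `γ`. -/
noncomputable def lam (n d : ℕ) (γ : Multiset ℕ) : ℕ :=
  (Finset.univ.filter (fun T : L n d => typeOf d T = γ)).card

/-- `κ_{n,d}(m,T)`: the number of `m`-element sets of `d`-element subsets of `{1,…,n}`
whose corresponding hyperplanes have least upper bound `T` in `L(n,d)`. -/
noncomputable def kappa (n d m : ℕ) (T : L n d) : ℕ :=
  (Finset.univ.filter (fun H : Coll n =>
      H.card = m ∧ (∀ X ∈ H, X.card = d) ∧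
      IsLUB {S : L n d | ∃ X ∈ H, S.val = {X}} T)).card

/-- The number of `b`-subsets meeting a given set `A` in exactly `k` points. -/
theorem card_filter_card_inter_eq {α : Type*} [Fintype α] [DecidableEq α] (A : Finset α) {b k : ℕ} (hk : k ≤ b) :
    (Finset.univ.filter (fun B : Finset α => B.card = b ∧ (A ∩ B).card = k)).card =
      A.card.choose k * (Fintype.card α - A.card).choose (b - k) := by
  rw [← Finset.card_compl, ← Finset.card_powersetCard, ← Finset.card_powersetCard,
    ← Finset.card_product]
  refine Finset.card_nbij' (fun B => (A ∩ B, B \ A)) (fun p => p.1 ∪ p.2) ?_ ?_ ?_ ?_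
  · intro B hB
    simp only [Finset.coe_filter, Finset.mem_univ, true_and, Set.mem_ofPred_eq] at hB
    have h := Finset.card_inter_add_card_sdiff B A
    rw [Finset.inter_comm B A] at h
    simp only [Finset.coe_product, Set.mem_prod, Finset.mem_coe, Finset.mem_powersetCard]
    refine ⟨⟨Finset.inter_subset_left, hB.2⟩, fun x hx => ?_, by omega⟩
    simp only [Finset.mem_sdiff] at hx
    simpa using hx.2
  · rintro ⟨U, V⟩ h
    simp only [Finset.coe_product, Set.mem_prod, Finset.mem_coe, Finset.mem_powersetCard] at h
    obtain ⟨⟨hU, rfl⟩, hV, hV'⟩ := h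
    have hd : Disjoint A V := Finset.subset_compl_iff_disjoint_left.mp hV
    simp only [Finset.coe_filter, Finset.mem_univ, true_and, Set.mem_ofPred_eq]
    rw [Finset.card_union_of_disjoint (hd.mono_left hU), Finset.inter_union_distrib_left,
      Finset.inter_eq_right.mpr hU, Finset.disjoint_iff_inter_eq_empty.mp hd, Finset.union_empty]
    exact ⟨by omega, rfl⟩
  · intro B _
    ext x
    simp only [Finset.mem_union, Finset.mem_inter, Finset.mem_sdiff]
    tauto
  · rintro ⟨U, V⟩ h
    simp only [Finset.coe_product, Set.mem_prod, Finset.mem_coe, Finset.mem_powersetCard] at h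
    obtain ⟨⟨hU, -⟩, hV, -⟩ := h
    have hV' : ∀ x ∈ V, x ∉ A := fun x hx => by simpa using hV hx
    refine Prod.ext ?_ ?_ <;> ext x <;> have h₁ := @hU x <;> have h₂ := hV' x <;>
      simp only [Finset.mem_union, Finset.mem_inter, Finset.mem_sdiff] <;> tauto

/-- The number of pairs of an `a`-subset and a `b`-subset meeting in exactly `k` points. -/
theorem card_filter_pair_card_inter_eq {α : Type*} [Fintype α] [DecidableEq α] {a b k : ℕ}
    (hka : k ≤ a) (hkb : k ≤ b) :
    (Finset.univ.filter (fun p : Finset α × Finset α =>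
      p.1.card = a ∧ p.2.card = b ∧ (p.1 ∩ p.2).card = k)).card =
      (Fintype.card α).choose k * (Fintype.card α - k).choose (a - k) *
        (Fintype.card α - a).choose (b - k) := by
  rw [← Nat.choose_mul hka, mul_assoc]
  have hcard := Finset.card_powersetCard a (Finset.univ : Finset α)
  rw [Finset.card_univ] at hcard
  rw [← hcard, ← smul_eq_mul, ← Finset.sum_const,
    Finset.card_eq_sum_card_fiberwise (f := Prod.fst)
      (t := Finset.powersetCard a (Finset.univ : Finset α))]
  · refine Finset.sum_congr rfl fun A hA => ?_
    obtain rfl : A.card = a := (Finset.mem_powersetCard.mp hA).2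
    rw [← card_filter_card_inter_eq A hkb]
    refine Finset.card_nbij' Prod.snd (fun B => (A, B)) ?_ ?_ ?_ ?_
    · rintro ⟨A', B⟩ h
      simp only [Finset.coe_filter, Finset.mem_filter, Finset.mem_univ, true_and,
        Set.mem_ofPred_eq] at h ⊢
      obtain ⟨h, rfl⟩ := h
      exact h.2
    · intro B h
      simpa using h
    · rintro ⟨A', B⟩ h
      simp only [Finset.coe_filter, Finset.mem_filter, Finset.mem_univ, true_and,
        Set.mem_ofPred_eq] at h
      rw [h.2]
    · intro B _
      rfl
  · intro p hp
    simp only [Finset.coe_filter, Finset.mem_univ, true_and, Set.mem_ofPred_eq] at hp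
    simp [Finset.mem_powersetCard, hp.1]

/-- Membership of a pair of distinct sets in `L(n,d)`. -/
theorem memL_pair_iff {n d : ℕ} {A B : Finset (Fin n)} (hAB : A ≠ B) :
    memL n d {A, B} ↔
      A.card ≤ d ∧ B.card ≤ d ∧ (A ∩ B).card + (d + 1) < A.card + B.card := by
  have hD : 0 < Dd d ({A, B} : Coll n) ↔ (A ∩ B).card + (d + 1) < A.card + B.card := by
    rw [Dd, rho, Finset.sum_pair hAB, Finset.inf_insert, Finset.inf_singleton]
    simp only [codim, id, Finset.inf_eq_inter]
    omega
  have hc : ({A, B} : Coll n).card = 2 := Finset.card_pair hAB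
  rw [memL, ← hD]
  constructor
  · rintro ⟨h, h'⟩
    exact ⟨h' A (by simp), h' B (by simp), h _ subset_rfl hc.ge⟩
  · rintro ⟨hA, hB, h⟩
    refine ⟨fun T hT hT2 => ?_, by simp [hA, hB]⟩
    rwa [Finset.eq_of_subset_of_card_le hT (hc.trans_le hT2)]

/-- For distinct `γ₁, γ₂`, elements of `L(n,d)` of type `{γ₁, γ₂}` correspond to ordered pairs. -/
theorem lam_pair_eq_card {n d γ₁ γ₂ : ℕ} (h12 : γ₂ < γ₁) (h2 : 1 ≤ γ₂) (h1 : γ₁ ≤ d + 1) :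
    lam n d {γ₁, γ₂} =
      (Finset.univ.filter (fun p : Finset (Fin n) × Finset (Fin n) =>
        p.1.card = d + 1 - γ₁ ∧ p.2.card = d + 1 - γ₂ ∧
          (p.1 ∩ p.2).card + (γ₁ + γ₂) ≤ d)).card := by
  symm
  have hne : ∀ p : Finset (Fin n) × Finset (Fin n),
      p.1.card = d + 1 - γ₁ → p.2.card = d + 1 - γ₂ → p.1 ≠ p.2 := by
    intro p hp hp' h
    rw [h] at hp
    omega
  refine Finset.card_bij (fun p hp => ⟨{p.1, p.2}, ?_⟩) ?_ ?_ ?_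
  · simp only [Finset.mem_filter, Finset.mem_univ, true_and] at hp
    rw [memL_pair_iff (hne p hp.1 hp.2.1)]
    omega
  · intro p hp
    simp only [Finset.mem_filter, Finset.mem_univ, true_and] at hp ⊢
    rw [typeOf, Finset.insert_val_of_notMem (by simpa using hne p hp.1 hp.2.1)]
    simp only [Finset.singleton_val, Multiset.map_cons, Multiset.map_singleton, hp.1, hp.2.1]
    rw [show d + 1 - (d + 1 - γ₁) = γ₁ by omega, show d + 1 - (d + 1 - γ₂) = γ₂ by omega]
    rfl
  · rintro ⟨A, B⟩ hp ⟨A', B'⟩ hq h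
    simp only [Finset.mem_filter, Finset.mem_univ, true_and] at hp hq
    have hA : A ∈ ({A', B'} : Coll n) := by
      rw [← L.mk.inj h]; simp
    have hB : B ∈ ({A', B'} : Coll n) := by
      rw [← L.mk.inj h]; simp
    simp only [Finset.mem_insert, Finset.mem_singleton] at hA hB
    rcases hA with rfl | rfl
    · rcases hB with rfl | rfl
      · omega
      · rfl
    · omega
  · intro T hT
    simp only [Finset.mem_filter, Finset.mem_univ, true_and] at hT
    obtain ⟨V, hV⟩ := T
    have hc : V.card = 2 := by
      have := congrArg Multiset.card hT
      simpa [typeOf] using this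
    obtain ⟨A, B, hAB, rfl⟩ := Finset.card_eq_two.mp hc
    rw [typeOf, Finset.insert_val_of_notMem (by simpa using hAB)] at hT
    simp only [Finset.singleton_val, Multiset.map_cons, Multiset.map_singleton] at hT
    have hL := (memL_pair_iff hAB).mp hV
    rcases Multiset.cons_eq_cons.mp hT with ⟨hA, hB⟩ | ⟨-, S, hB, hA⟩
    · have hB := Multiset.singleton_inj.mp hB
      refine ⟨(A, B), ?_, rfl⟩
      simp only [Finset.mem_filter, Finset.mem_univ, true_and]
      omega
    · have hB := (Multiset.singleton_eq_cons_iff S).mp hB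
      have hA := (Multiset.singleton_eq_cons_iff S).mp hA
      refine ⟨(B, A), ?_, by simp only [Finset.pair_comm]⟩
      simp only [Finset.mem_filter, Finset.mem_univ, true_and, Finset.inter_comm B A]
      omega

/-- For integers `γ₁ > γ₂ ≥ 1`, with `t₁ = d + 1 − γ₁` and
`t₂ = d + 1 − γ₂`,
`λ_{n,d}((γ₁,γ₂)) = Σ_{ν=0}^{min(t₁,t₂,d−γ₁−γ₂)} C(n,ν)·C(n−ν,t₁−ν)·C(n−t₁,t₂−ν)`,
the sum being empty (both sides `0`) when `d − γ₁ − γ₂ < 0` or `t₁ < 0`. -/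
theorem lam_two_parts_ne (n d : ℕ) (hd : 1 ≤ d) (hnd : d < n)
    (γ₁ γ₂ : ℕ) (h12 : γ₂ < γ₁) (h2 : 1 ≤ γ₂) :
    lam n d {γ₁, γ₂} =
      if γ₁ + γ₂ ≤ d then
        ∑ ν ∈ Finset.range
            (min (d + 1 - γ₁) (min (d + 1 - γ₂) (d - γ₁ - γ₂)) + 1),
          Nat.choose n ν * Nat.choose (n - ν) (d + 1 - γ₁ - ν) *
            Nat.choose (n - (d + 1 - γ₁)) (d + 1 - γ₂ - ν)
      else 0 := by
  have hcard : Fintype.card (Fin n) = n := Fintype.card_fin n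
  split_ifs with h
  · rw [lam_pair_eq_card h12 h2 (by omega),
      Finset.card_eq_sum_card_fiberwise
        (f := fun p : Finset (Fin n) × Finset (Fin n) => (p.1 ∩ p.2).card)
        (t := Finset.range (min (d + 1 - γ₁) (min (d + 1 - γ₂) (d - γ₁ - γ₂)) + 1))]
    · refine Finset.sum_congr rfl fun ν hν => ?_
      rw [Finset.mem_range] at hν
      have hcount := card_filter_pair_card_inter_eq (α := Fin n) (a := d + 1 - γ₁)
        (b := d + 1 - γ₂) (k := ν) (by omega) (by omega)
      rw [hcard] at hcount
      rw [← hcount, Finset.filter_filter]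
      congr 1
      refine Finset.filter_congr fun p _ => ?_
      omega
    · intro p hp
      simp only [Finset.coe_filter, Finset.mem_univ, true_and, Set.mem_ofPred_eq] at hp
      have h₁ := Finset.card_le_card (Finset.inter_subset_left (s₁ := p.1) (s₂ := p.2))
      have h₂ := Finset.card_le_card (Finset.inter_subset_right (s₁ := p.1) (s₂ := p.2))
      simp only [Finset.coe_range, Set.mem_Iio]
      omega
  · by_cases h1 : γ₁ ≤ d + 1
    · rw [lam_pair_eq_card h12 h2 h1, Finset.card_eq_zero, Finset.filter_eq_empty_iff]
      intro p _
      omega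
    · rw [lam, Finset.card_eq_zero, Finset.filter_eq_empty_iff]
      intro T _ hT
      have hmem : γ₁ ∈ typeOf d T := by simp [hT]
      obtain ⟨X, -, hX⟩ := Multiset.mem_map.mp hmem
      omega
end

section
/- Let d ≥ 1, n > d, and let γ ≥ 1 be an integer. Set t = d + 1 − γ. Then 2 · λ_{n,d}((γ, γ)) = Σ_{ν=0}^{min(t, d−2γ)} C(n, ν) · C(n−ν, t−ν) · C(n−t, t−ν), where C(a,b) denotes the binomial coefficient and the sum is empty (both sides equal 0) when d − 2γ < 0. -/
attribute [local instance] Classical.propDecidable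

theorem card_filter_card_inter {α : Type*} [Fintype α] [DecidableEq α] (A : Finset α)
    (t ν : ℕ) (hν : ν ≤ t) :
    (Finset.univ.filter (fun B : Finset α => B.card = t ∧ (A ∩ B).card = ν)).card =
      Nat.choose A.card ν * Nat.choose (Fintype.card α - A.card) (t - ν) := by
  rw [← Finset.card_compl A, ← Finset.card_powersetCard, ← Finset.card_powersetCard,
    ← Finset.card_product]
  refine Finset.card_nbij' (fun B => (A ∩ B, B \ A)) (fun p => p.1 ∪ p.2) ?_ ?_ ?_ ?_
  · intro B hB
    simp only [Finset.mem_coe, Finset.mem_filter, Finset.mem_univ, true_and] at hB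
    have h := Finset.card_sdiff_add_card_inter B A
    rw [Finset.inter_comm] at h
    simp only [Finset.mem_coe, Finset.mem_product, Finset.mem_powersetCard]
    refine ⟨⟨Finset.inter_subset_left, hB.2⟩, fun x hx => ?_, by omega⟩
    exact Finset.mem_compl.2 (Finset.mem_sdiff.1 hx).2
  · rintro ⟨I, J⟩ h
    simp only [Finset.mem_coe, Finset.mem_product, Finset.mem_powersetCard] at h
    obtain ⟨⟨hI, hIc⟩, hJ, hJc⟩ := h
    have hAJ : Disjoint A J := (Finset.subset_compl_iff_disjoint_left).1 hJ
    have hIJ : Disjoint I J := Finset.disjoint_of_subset_left hI hAJ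
    simp only [Finset.mem_coe, Finset.mem_filter, Finset.mem_univ, true_and]
    rw [Finset.card_union_of_disjoint hIJ, Finset.inter_union_distrib_left,
      Finset.inter_eq_right.2 hI, Finset.disjoint_iff_inter_eq_empty.1 hAJ, Finset.union_empty]
    exact ⟨by omega, hIc⟩
  · intro B _
    ext x
    by_cases hx : x ∈ A <;> simp [hx]
  · rintro ⟨I, J⟩ h
    simp only [Finset.mem_coe, Finset.mem_product, Finset.mem_powersetCard] at h
    obtain ⟨⟨hI, -⟩, hJ, -⟩ := h
    ext x
    · have := @hI x
      have := @hJ x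
      simp only [Finset.mem_compl] at this
      simp only [Finset.mem_inter, Finset.mem_union]
      tauto
    · have := @hI x
      have := @hJ x
      simp only [Finset.mem_compl] at this
      simp only [Finset.mem_sdiff, Finset.mem_union]
      tauto

theorem card_filter_pairs_card_inter {α : Type*} [Fintype α] [DecidableEq α]
    (t ν : ℕ) (hν : ν ≤ t) :
    (Finset.univ.filter (fun p : Finset α × Finset α =>
        p.1.card = t ∧ p.2.card = t ∧ (p.1 ∩ p.2).card = ν)).card =
      Nat.choose (Fintype.card α) ν * Nat.choose (Fintype.card α - ν) (t - ν) *
        Nat.choose (Fintype.card α - t) (t - ν) := by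
  rw [Finset.card_eq_sum_card_fiberwise (f := Prod.fst)
    (t := Finset.powersetCard t (Finset.univ : Finset α))
    (fun p hp => by
      simp only [Finset.mem_coe, Finset.mem_filter, Finset.mem_univ, true_and] at hp
      simpa using hp.1)]
  have key : ∀ A ∈ Finset.powersetCard t (Finset.univ : Finset α),
      ((Finset.univ.filter (fun p : Finset α × Finset α =>
        p.1.card = t ∧ p.2.card = t ∧ (p.1 ∩ p.2).card = ν)).filter (fun p => p.1 = A)).card =
        Nat.choose t ν * Nat.choose (Fintype.card α - t) (t - ν) := by
    intro A hA
    have hAt : A.card = t := (Finset.mem_powersetCard.1 hA).2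
    have h := card_filter_card_inter A t ν hν
    rw [hAt] at h
    rw [← h]
    refine Finset.card_nbij' Prod.snd (fun B => (A, B)) ?_ ?_ ?_ ?_
    · rintro ⟨A', B⟩ h
      simp only [Finset.mem_coe, Finset.mem_filter, Finset.mem_univ, true_and] at h ⊢
      obtain ⟨⟨-, h1, h2⟩, rfl⟩ := h
      exact ⟨h1, h2⟩
    · intro B h
      simp only [Finset.mem_coe, Finset.mem_filter, Finset.mem_univ, true_and] at h ⊢
      exact ⟨⟨hAt, h⟩, trivial⟩
    · rintro ⟨A', B⟩ h
      simp only [Finset.mem_coe, Finset.mem_filter, Finset.mem_univ, true_and] at h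
      rw [h.2]
    · intro B _
      rfl
  rw [Finset.sum_congr rfl key, Finset.sum_const, Finset.card_powersetCard, Finset.card_univ,
    smul_eq_mul, ← mul_assoc]
  congr 1
  exact Nat.choose_mul hν

theorem Dd_pair_pos_iff {n d γ : ℕ} {A B : Finset (Fin n)} (hAB : A ≠ B)
    (hA : A.card + γ = d + 1) (hB : B.card + γ = d + 1) :
    0 < Dd d ({A, B} : Coll n) ↔ (A ∩ B).card + 2 * γ ≤ d := by
  have h : Dd d ({A, B} : Coll n) = codim d (A ∩ B) - (codim d A + codim d B) := by
    unfold Dd rho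
    rw [Finset.sum_pair hAB]
    simp
  rw [h]
  unfold codim
  omega

theorem typeOf_eq_pair_iff {n d γ : ℕ} (hγ : 1 ≤ γ) (T : L n d) :
    typeOf d T = {γ, γ} ↔ ∃ A B, A ≠ B ∧ T.val = {A, B} ∧ A.card + γ = d + 1 ∧
      B.card + γ = d + 1 ∧ (A ∩ B).card + 2 * γ ≤ d := by
  constructor
  · intro h
    have hcard : T.val.card = 2 := by
      have := congrArg Multiset.card h
      simpa [typeOf] using this
    obtain ⟨A, B, hAB, hT⟩ := Finset.card_eq_two.1 hcard
    have hmem : ∀ X ∈ T.val, X.card + γ = d + 1 := by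
      intro X hX
      have h1 : d + 1 - X.card ∈ typeOf d T :=
        Multiset.mem_map_of_mem (fun X : Finset (Fin n) => d + 1 - X.card) hX
      rw [h] at h1
      simp at h1
      omega
    have hA := hmem A (by simp [hT])
    have hB := hmem B (by simp [hT])
    have hD := T.mem.1 T.val subset_rfl hcard.ge
    rw [hT] at hD
    exact ⟨A, B, hAB, hT, hA, hB, (Dd_pair_pos_iff hAB hA hB).1 hD⟩
  · rintro ⟨A, B, hAB, hT, hA, hB, -⟩
    have hval : T.val.val = A ::ₘ {B} := by
      rw [hT, Finset.insert_val_of_notMem (by simpa using hAB)]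
      rfl
    unfold typeOf
    rw [hval, Multiset.map_cons, Multiset.map_singleton, show d + 1 - A.card = γ by omega,
      show d + 1 - B.card = γ by omega]
    rfl

theorem memL_pair {n d γ : ℕ} (hγ : 1 ≤ γ) {A B : Finset (Fin n)} (hAB : A ≠ B)
    (hA : A.card + γ = d + 1) (hB : B.card + γ = d + 1)
    (hI : (A ∩ B).card + 2 * γ ≤ d) : memL n d {A, B} := by
  constructor
  · intro T' hT' h2
    have : T' = {A, B} :=
      Finset.eq_of_subset_of_card_le hT' ((Finset.card_pair hAB).trans_le h2)
    rw [this]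
    exact (Dd_pair_pos_iff hAB hA hB).2 hI
  · intro X hX
    rcases Finset.mem_insert.1 hX with rfl | hX
    · omega
    · rw [Finset.mem_singleton.1 hX]
      omega

theorem ne_of_card_inter_add_le {n d γ : ℕ} (hγ : 1 ≤ γ) {A B : Finset (Fin n)}
    (hA : A.card + γ = d + 1) (hI : (A ∩ B).card + 2 * γ ≤ d) : A ≠ B := by
  rintro rfl
  rw [Finset.inter_self] at hI
  omega

theorem two_mul_lam_eq_card_pairs (n d γ : ℕ) (hγ : 1 ≤ γ) :
    2 * lam n d {γ, γ} =
      (Finset.univ.filter (fun p : Finset (Fin n) × Finset (Fin n) =>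
        p.1.card + γ = d + 1 ∧ p.2.card + γ = d + 1 ∧
          (p.1 ∩ p.2).card + 2 * γ ≤ d)).card := by
  have hinj : Function.Injective (fun T : L n d => T.val) := by
    rintro ⟨S, _⟩ ⟨T, _⟩ h
    simpa using h
  rw [lam, ← Finset.card_image_of_injective _ hinj, mul_comm]
  symm
  rw [Finset.card_eq_sum_card_fiberwise
    (f := fun p : Finset (Fin n) × Finset (Fin n) => ({p.1, p.2} : Coll n))
    (t := (Finset.univ.filter (fun T : L n d => typeOf d T = {γ, γ})).image (fun T => T.val))]
  · refine Finset.sum_const_nat fun S hS => ?_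
    obtain ⟨T, hmem, rfl⟩ := Finset.mem_image.1 hS
    obtain ⟨A, B, hAB, hT, hA, hB, hI⟩ :=
      (typeOf_eq_pair_iff hγ T).1 (Finset.mem_filter.1 hmem).2
    rw [hT]
    refine Eq.trans (congrArg Finset.card (?_ : _ = {(A, B), (B, A)}))
      (Finset.card_pair fun h => hAB (congrArg Prod.fst h))
    ext ⟨X, Y⟩
    simp only [Finset.mem_filter, Finset.mem_univ, true_and, Finset.mem_insert,
      Finset.mem_singleton, Prod.mk.injEq]
    constructor
    · rintro ⟨⟨hX, hY, hXY⟩, h⟩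
      have hne := ne_of_card_inter_add_le hγ hX hXY
      have h1 : X ∈ ({A, B} : Coll n) := by rw [← h]; simp
      have h2 : Y ∈ ({A, B} : Coll n) := by rw [← h]; simp
      simp only [Finset.mem_insert, Finset.mem_singleton] at h1 h2
      rcases h1 with rfl | rfl <;> rcases h2 with rfl | rfl <;> simp_all
    · rintro (⟨rfl, rfl⟩ | ⟨rfl, rfl⟩)
      · exact ⟨⟨hA, hB, hI⟩, rfl⟩
      · exact ⟨⟨hB, hA, by rwa [Finset.inter_comm]⟩, Finset.pair_comm _ _⟩
  · rintro ⟨A, B⟩ h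
    obtain ⟨hA, hB, hI⟩ := (Finset.mem_filter.1 h).2
    have hAB := ne_of_card_inter_add_le hγ hA hI
    exact Finset.mem_image.2 ⟨⟨{A, B}, memL_pair hγ hAB hA hB hI⟩,
      Finset.mem_filter.2 ⟨Finset.mem_univ _,
        (typeOf_eq_pair_iff hγ _).2 ⟨A, B, hAB, rfl, hA, hB, hI⟩⟩, rfl⟩

/-- For an integer `γ ≥ 1`, with `t = d + 1 − γ`,
`2·λ_{n,d}((γ,γ)) = Σ_{ν=0}^{min(t, d−2γ)} C(n,ν)·C(n−ν,t−ν)·C(n−t,t−ν)`,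
the sum being empty (both sides `0`) when `d − 2γ < 0`. -/
theorem lam_two_parts_eq (n d : ℕ) (hd : 1 ≤ d) (hnd : d < n)
    (γ : ℕ) (hγ : 1 ≤ γ) :
    2 * lam n d {γ, γ} =
      if 2 * γ ≤ d then
        ∑ ν ∈ Finset.range (min (d + 1 - γ) (d - 2 * γ) + 1),
          Nat.choose n ν * Nat.choose (n - ν) (d + 1 - γ - ν) *
            Nat.choose (n - (d + 1 - γ)) (d + 1 - γ - ν)
      else 0 := by
  rw [two_mul_lam_eq_card_pairs n d γ hγ]
  split_ifs with h
  · rw [Finset.card_eq_sum_card_fiberwise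
      (f := fun p : Finset (Fin n) × Finset (Fin n) => (p.1 ∩ p.2).card)
      (t := Finset.range (min (d + 1 - γ) (d - 2 * γ) + 1))]
    · refine Finset.sum_congr rfl fun ν hν => ?_
      rw [Finset.mem_range] at hν
      have key := card_filter_pairs_card_inter (α := Fin n) (d + 1 - γ) ν (by omega)
      rw [Fintype.card_fin] at key
      rw [← key]
      congr 1
      ext p
      simp only [Finset.mem_filter, Finset.mem_univ, true_and]
      omega
    · rintro p hp
      obtain ⟨hA, hB, hI⟩ := (Finset.mem_filter.1 hp).2
      simp only [Finset.coe_range, Set.mem_Iio]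
      omega
  · rw [Finset.card_eq_zero, Finset.filter_eq_empty_iff]
    rintro p - ⟨-, -, hI⟩
    omega
end

section
/- Let d ≥ 1, n > d, let T = {T_1,…,T_l} ∈ L(n,d) with l ≥ 1 and T ≠ {∅}, and let m ≥ 1 be an integer. Define M(m,T) to be the set of l-tuples (m_1,…,m_l) of positive integers such that m_i ≥ codim_d(T_i) for all i, m_i = 1 whenever codim_d(T_i) = 1, and m_1 + … + m_l = m. Then κ_{n,d}(m, T) = Σ_{(m_1,…,m_l) ∈ M(m,T)} ∏_{i=1}^l κ_{n−|T_i|, d−|T_i|}(m_i, ⊤_i), where ⊤_i denotes the maximum element {∅} of L(n−|T_i|, d−|T_i|), and with the convention κ_{n',0}(1, ⊤) = 1 for the factors with d − |T_i| = 0. -/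
attribute [local instance] Classical.propDecidable

/-- Every member of `S` contains a member of `T`. -/
def Refines {n : ℕ} (S T : Coll n) : Prop := ∀ X ∈ S, ∃ Y ∈ T, Y ⊆ X

theorem Refines.trans {n : ℕ} {S T U : Coll n} (h : Refines S T) (h' : Refines T U) :
    Refines S U := by
  intro X hX
  obtain ⟨Y, hY, hYX⟩ := h X hX
  obtain ⟨Z, hZ, hZY⟩ := h' Y hY
  exact ⟨Z, hZ, hZY.trans hYX⟩

theorem Refines.of_subset {n : ℕ} {S T : Coll n} (h : S ⊆ T) : Refines S T :=
  fun X hX => ⟨X, h hX, subset_rfl⟩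

theorem refines_singleton {n : ℕ} {S : Coll n} {Z : Finset (Fin n)} :
    Refines S {Z} ↔ ∀ X ∈ S, Z ⊆ X := by
  simp [Refines]

theorem singleton_refines {n : ℕ} {S : Coll n} {Z : Finset (Fin n)} :
    Refines {Z} S ↔ ∃ Y ∈ S, Y ⊆ Z := by
  simp [Refines]

theorem codim_anti {n d : ℕ} {X Y : Finset (Fin n)} (h : Y ⊆ X) : codim d X ≤ codim d Y := by
  have := Finset.card_le_card h
  unfold codim
  omega

theorem mem_inf_id {n : ℕ} {S : Coll n} {x : Fin n} : x ∈ S.inf id ↔ ∀ X ∈ S, x ∈ X := by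
  simp [Finset.mem_inf]

theorem subset_inf_id {n : ℕ} {S : Coll n} {Y : Finset (Fin n)} :
    Y ⊆ S.inf id ↔ ∀ X ∈ S, Y ⊆ X := by
  simp

theorem rho_singleton {n d : ℕ} (X : Finset (Fin n)) : rho d {X} = codim d X := by
  simp [rho]

/-- The codimensions of the members of a fiber add up to at most the codimension of a common
subset, with equality only for the singleton fiber. -/
theorem rho_le_codim {n d : ℕ} {F : Coll n} {Y : Finset (Fin n)} (hY : Y.card ≤ d)
    (hF : 2 ≤ F.card → 0 < Dd d F) (hYF : ∀ X ∈ F, Y ⊆ X) :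
    rho d F ≤ codim d Y ∧ (rho d F = codim d Y → F = {Y}) := by
  rcases lt_or_ge F.card 2 with h | h
  · rcases Nat.lt_succ_iff_lt_or_eq.mp h with h0 | h1
    · have : F = ∅ := by rw [← Finset.card_eq_zero]; omega
      subst this
      have : 0 < codim d Y := by unfold codim; omega
      simp only [rho, Finset.sum_empty]
      exact ⟨this.le, fun h => absurd h this.ne⟩
    · obtain ⟨X, rfl⟩ := Finset.card_eq_one.mp h1
      have hYX := hYF X (by simp)
      rw [rho_singleton]
      refine ⟨codim_anti hYX, fun h => ?_⟩
      have : X.card = Y.card := by unfold codim at h; omega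
      rw [Finset.eq_of_subset_of_card_le hYX this.le]
  · have h1 := hF h
    have h2 : codim d (F.inf id) ≤ codim d Y := codim_anti (subset_inf_id.mpr hYF)
    unfold Dd at h1
    exact ⟨by omega, fun h => by omega⟩

theorem rho_eq_sum_fiber {n d : ℕ} {S J : Coll n} {φ : Finset (Fin n) → Finset (Fin n)}
    (h : ∀ X ∈ S, φ X ∈ J) : rho d S = ∑ Y ∈ J, rho d {X ∈ S | φ X = Y} :=
  (Finset.sum_fiberwise_of_maps_to h _).symm

theorem eq_or_rho_lt_of_refines {n d : ℕ} {S T : Coll n} (hS : memL n d S) (hT : memL n d T)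
    (h : Refines S T) : S = T ∨ rho d S < rho d T := by
  choose! φ hφ hφX using h
  have key : ∀ Y ∈ T, rho d {X ∈ S | φ X = Y} ≤ codim d Y ∧
      (rho d {X ∈ S | φ X = Y} = codim d Y → {X ∈ S | φ X = Y} = {Y}) := by
    intro Y hY
    refine rho_le_codim (hT.2 Y hY) (hS.1 _ (Finset.filter_subset _ _)) ?_
    intro X hX
    rw [Finset.mem_filter] at hX
    exact hX.2 ▸ hφX X hX.1
  rw [or_iff_not_imp_right, not_lt]
  intro hle
  have hsum : ∑ Y ∈ T, rho d {X ∈ S | φ X = Y} = ∑ Y ∈ T, codim d Y := by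
    apply le_antisymm (Finset.sum_le_sum fun Y hY => (key Y hY).1)
    rw [← rho_eq_sum_fiber hφ]
    exact hle
  have heq := (Finset.sum_eq_sum_iff_of_le fun Y hY => (key Y hY).1).mp hsum
  have hfib : ∀ Y ∈ T, {X ∈ S | φ X = Y} = {Y} := fun Y hY => (key Y hY).2 (heq Y hY)
  ext X
  constructor
  · intro hX
    have h1 : X ∈ ({X' ∈ S | φ X' = φ X} : Coll n) := by simp [hX]
    rw [hfib _ (hφ X hX), Finset.mem_singleton] at h1
    exact h1 ▸ hφ X hX
  · intro hX
    have h1 : X ∈ ({X' ∈ S | φ X' = X} : Coll n) := by simp [hfib X hX]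
    exact (Finset.mem_filter.mp h1).1

theorem le_iff_refines {n d : ℕ} (S T : L n d) : S ≤ T ↔ Refines S.val T.val := by
  constructor
  · rintro (rfl | h)
    · exact Refines.of_subset subset_rfl
    · exact h.2
  · intro h
    rcases eq_or_rho_lt_of_refines S.mem T.mem h with h' | h'
    · left
      cases S; cases T; simpa using h'
    · exact Or.inr ⟨h', h⟩

/-- Enlarging the members of a collection enlarges the intersection by at most the total growth. -/
theorem card_inf_add_sum_le {n : ℕ} (J : Coll n) (B : Finset (Fin n) → Finset (Fin n))
    (hB : ∀ Y ∈ J, Y ⊆ B Y) :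
    (J.inf B).card + ∑ Y ∈ J, Y.card ≤ (J.inf id).card + ∑ Y ∈ J, (B Y).card := by
  have h1 : J.inf B ⊆ J.inf id ∪ J.biUnion fun Y => B Y \ Y := by
    intro x hx
    rw [Finset.mem_inf] at hx
    by_cases h : x ∈ J.inf id
    · exact Finset.mem_union_left _ h
    · rw [mem_inf_id] at h
      push Not at h
      obtain ⟨Y, hY, hxY⟩ := h
      exact Finset.mem_union_right _
        (Finset.mem_biUnion.mpr ⟨Y, hY, Finset.mem_sdiff.mpr ⟨hx Y hY, hxY⟩⟩)
  have h2 := (Finset.card_le_card h1).trans (Finset.card_union_le _ _)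
  have h3 : (J.biUnion fun Y => B Y \ Y).card ≤ ∑ Y ∈ J, (B Y \ Y).card := Finset.card_biUnion_le
  have h4 : ∑ Y ∈ J, (B Y).card = ∑ Y ∈ J, (B Y \ Y).card + ∑ Y ∈ J, Y.card := by
    rw [← Finset.sum_add_distrib]
    exact Finset.sum_congr rfl fun Y hY => (Finset.card_sdiff_add_card_eq_card (hB Y hY)).symm
  omega

/-- A minimal collection violating the defining inequality of `L(n,d)` and refining an element
of `L(n,d)` lies above a single member of that element. -/
theorem exists_subset_inf_of_minimal {n d : ℕ} {U S : Coll n} (hU : memL n d U)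
    (hSU : Refines S U) (hcard : 2 ≤ S.card) (hD : Dd d S ≤ 0)
    (hmin : ∀ S' ⊂ S, 2 ≤ S'.card → 0 < Dd d S') : ∃ Y ∈ U, Y ⊆ S.inf id := by
  choose! φ hφ hφX using hSU
  set J := S.image φ with hJ
  have hJU : J ⊆ U := by
    intro Y hY
    obtain ⟨X, hX, rfl⟩ := Finset.mem_image.mp hY
    exact hφ X hX
  by_cases hconst : ∃ Y ∈ U, ∀ X ∈ S, φ X = Y
  · obtain ⟨Y, hY, h⟩ := hconst
    exact ⟨Y, hY, subset_inf_id.mpr fun X hX => h X hX ▸ hφX X hX⟩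
  exfalso
  push Not at hconst
  obtain ⟨X₀, hX₀⟩ : S.Nonempty := Finset.card_pos.mp (by omega)
  have hJ2 : 2 ≤ J.card := by
    obtain ⟨X₁, hX₁, hne⟩ := hconst (φ X₀) (hφ _ hX₀)
    exact Finset.one_lt_card.mpr ⟨_, Finset.mem_image_of_mem φ hX₁, _,
      Finset.mem_image_of_mem φ hX₀, hne⟩
  let B : Finset (Fin n) → Finset (Fin n) := fun Y => ({X ∈ S | φ X = Y} : Coll n).inf id
  have hB : ∀ Y ∈ J, Y ⊆ B Y := by
    intro Y _
    refine subset_inf_id.mpr fun X hX => ?_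
    rw [Finset.mem_filter] at hX
    exact hX.2 ▸ hφX X hX.1
  have hfiber : ∀ Y ∈ J, rho d {X ∈ S | φ X = Y} ≤ codim d (B Y) := by
    intro Y hY
    have hss : ({X ∈ S | φ X = Y} : Coll n) ⊂ S := by
      refine Finset.filter_ssubset.mpr ?_
      obtain ⟨X, hX, hne⟩ := hconst Y (hJU hY)
      exact ⟨X, hX, hne⟩
    obtain ⟨X, hX, rfl⟩ := Finset.mem_image.mp hY
    have hne : 0 < ({X' ∈ S | φ X' = φ X} : Coll n).card :=
      Finset.card_pos.mpr ⟨X, by simp [hX]⟩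
    rcases Nat.lt_or_ge ({X' ∈ S | φ X' = φ X} : Coll n).card 2 with h | h
    · obtain ⟨Z, hZ⟩ := Finset.card_eq_one.mp (by omega :
        ({X' ∈ S | φ X' = φ X} : Coll n).card = 1)
      simp only [B, hZ, rho_singleton]
      simp
    · have := hmin _ hss h
      unfold Dd at this
      simp only [B]
      omega
  have hinf : J.inf B = S.inf id := by
    ext x
    simp only [Finset.mem_inf, B, hJ, Finset.mem_image, Finset.mem_filter, id]
    constructor
    · intro h X hX
      exact h (φ X) ⟨X, hX, rfl⟩ X ⟨hX, rfl⟩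
    · intro h Y _ X hX
      exact h X hX.1
  have h1 := card_inf_add_sum_le J B hB
  have h2 := hU.1 J hJU hJ2
  have h3 : rho d S = ∑ Y ∈ J, rho d {X ∈ S | φ X = Y} :=
    rho_eq_sum_fiber fun X hX => Finset.mem_image_of_mem φ hX
  have h4 := Finset.sum_le_sum hfiber
  have h5 : ∑ Y ∈ J, codim d (B Y) + ∑ Y ∈ J, ((B Y).card : ℤ) =
      ∑ Y ∈ J, codim d Y + ∑ Y ∈ J, (Y.card : ℤ) := by
    rw [← Finset.sum_add_distrib, ← Finset.sum_add_distrib]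
    exact Finset.sum_congr rfl fun Y _ => by unfold codim; ring
  rw [hinf] at h1
  zify at h1
  unfold Dd at h2 hD
  rw [rho] at h2
  unfold codim at h2 hD h4 h5
  omega

theorem rho_union_le {n d : ℕ} {S T : Coll n} (hS : ∀ X ∈ S, X.card ≤ d) :
    rho d (S ∪ T) ≤ rho d S + rho d T := by
  have h := Finset.sum_union_inter (s₁ := S) (s₂ := T) (f := codim d)
  have h0 : 0 ≤ ∑ X ∈ S ∩ T, codim d X := Finset.sum_nonneg fun X hX => by
    have := hS X (Finset.mem_inter.mp hX).1
    unfold codim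
    omega
  unfold rho
  omega

theorem rho_biUnion_le {n d : ℕ} (T : Coll n) (g : Finset (Fin n) → Coll n)
    (hg : ∀ X ∈ T, ∀ Y ∈ g X, Y.card ≤ d) :
    rho d (T.biUnion g) ≤ ∑ X ∈ T, rho d (g X) := by
  induction T using Finset.induction_on with
  | empty => simp [rho]
  | insert X T hX ih =>
    rw [Finset.biUnion_insert, Finset.sum_insert hX]
    have h1 := ih fun Y hY => hg Y (Finset.mem_insert_of_mem hY)
    have h2 := rho_union_le (T := T.biUnion g) (hg X (Finset.mem_insert_self _ _))
    omega

/-- Every collection of sets of size at most `d` generates an element of `L(n,d)`: the least one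
it refines. -/
theorem exists_closure {n d : ℕ} (C : Coll n) (hC : ∀ X ∈ C, X.card ≤ d) :
    ∃ S, memL n d S ∧ Refines C S ∧ (∀ U, memL n d U → Refines C U → Refines S U) ∧
      rho d S ≤ rho d C := by
  induction hk : C.card using Nat.strong_induction_on generalizing C with
  | _ k ih =>
    by_cases hmem : memL n d C
    · exact ⟨C, hmem, Refines.of_subset subset_rfl, fun _ _ h => h, le_rfl⟩
    have hbad : ∃ V : Coll n, V ⊆ C ∧ 2 ≤ V.card ∧ Dd d V ≤ 0 := by
      by_contra hcon
      push Not at hcon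
      exact hmem ⟨fun V hV hV2 => hcon V hV hV2, hC⟩
    obtain ⟨V, ⟨hVC, hV2, hVD⟩, hVmin⟩ :=
      exists_minimal_of_wellFoundedLT (fun V : Coll n => V ⊆ C ∧ 2 ≤ V.card ∧ Dd d V ≤ 0) hbad
    have hmin : ∀ V' ⊂ V, 2 ≤ V'.card → 0 < Dd d V' := by
      intro V' hV' h2
      by_contra hcon
      exact hV'.2 (hVmin ⟨hV'.1.trans hVC, h2, not_lt.mp hcon⟩ hV'.1)
    obtain ⟨X₀, hX₀⟩ : V.Nonempty := Finset.card_pos.mp (by omega)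
    have hVinf : ∀ X ∈ V, V.inf id ⊆ X := subset_inf_id.mp subset_rfl
    have hle : ∀ X ∈ C \ V ∪ {V.inf id}, X.card ≤ d := by
      intro X hX
      rw [Finset.mem_union, Finset.mem_singleton, Finset.mem_sdiff] at hX
      rcases hX with hX | rfl
      · exact hC X hX.1
      · exact (Finset.card_le_card (hVinf X₀ hX₀)).trans (hC X₀ (hVC hX₀))
    have hlt : (C \ V ∪ {V.inf id}).card < k := by
      have h1 := Finset.card_union_le (C \ V) {V.inf id}
      have h2 := Finset.card_sdiff_add_card_eq_card hVC
      rw [Finset.card_singleton] at h1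
      omega
    obtain ⟨S, hS, hCS, hSU, hrho⟩ := ih _ hlt _ hle rfl
    refine ⟨S, hS, Refines.trans ?_ hCS, fun U hU hCU => hSU U hU ?_, hrho.trans ?_⟩
    · intro X hX
      by_cases hXV : X ∈ V
      · exact ⟨_, by simp, hVinf X hXV⟩
      · exact ⟨X, by simp [hX, hXV], subset_rfl⟩
    · intro X hX
      rw [Finset.mem_union, Finset.mem_singleton, Finset.mem_sdiff] at hX
      rcases hX with hX | rfl
      · exact hCU X hX.1
      · exact exists_subset_inf_of_minimal hU (fun X hX => hCU X (hVC hX)) hV2 hVD hmin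
    · have h1 := rho_union_le (d := d) (S := C \ V) (T := {V.inf id})
        fun X hX => hC X (Finset.mem_sdiff.mp hX).1
      have h2 : rho d (C \ V) + rho d V = rho d C := Finset.sum_sdiff hVC
      rw [rho_singleton] at h1
      unfold Dd at hVD
      omega

/-- `T` is the least element of `L(n,d)` refined by `H`. -/
def IsClosure {n : ℕ} (d : ℕ) (H T : Coll n) : Prop :=
  Refines H T ∧ ∀ U, memL n d U → Refines H U → Refines T U

theorem isLUB_iff_isClosure {n d : ℕ} (H : Coll n) (hH : ∀ X ∈ H, X.card = d) (T : L n d) :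
    IsLUB {S : L n d | ∃ X ∈ H, S.val = {X}} T ↔ IsClosure d H T.val := by
  have hub : ∀ U : L n d, U ∈ upperBounds {S : L n d | ∃ X ∈ H, S.val = {X}} ↔
      Refines H U.val := by
    intro U
    constructor
    · intro h X hX
      have h1 := (le_iff_refines _ _).mp
        (h (show singL n d X (hH X hX).le ∈ _ from ⟨X, hX, rfl⟩))
      exact h1 X (by simp [singL])
    · rintro h S ⟨X, hX, hS⟩
      rw [le_iff_refines, hS, singleton_refines]
      exact h X hX
  unfold IsLUB IsLeast IsClosure
  rw [hub]
  refine and_congr_right fun _ => ⟨fun h U hU hHU => ?_, fun h U hU => ?_⟩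
  · exact (le_iff_refines _ _).mp (h ((hub ⟨U, hU⟩).mpr hHU))
  · exact (le_iff_refines _ _).mpr (h _ U.mem ((hub U).mp hU))

/-- The sets of `d`-element sets generating `T`. -/
noncomputable def generators {n : ℕ} (d : ℕ) (T : Coll n) : Finset (Coll n) :=
  Finset.univ.filter fun H => (∀ X ∈ H, X.card = d) ∧ IsClosure d H T

theorem mem_generators {n d : ℕ} {H T : Coll n} :
    H ∈ generators d T ↔ (∀ X ∈ H, X.card = d) ∧ IsClosure d H T := by
  simp [generators]

theorem kappa_eq_card {n d m : ℕ} (T : L n d) :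
    kappa n d m T = ((generators d T.val).filter fun H => H.card = m).card := by
  unfold kappa generators
  rw [Finset.filter_filter]
  congr 1
  ext H
  simp only [Finset.mem_filter, Finset.mem_univ, true_and]
  constructor
  · rintro ⟨h1, h2, h3⟩
    exact ⟨⟨h2, (isLUB_iff_isClosure H h2 T).mp h3⟩, h1⟩
  · rintro ⟨⟨h2, h3⟩, h1⟩
    exact ⟨h1, h2, (isLUB_iff_isClosure H h2 T).mpr h3⟩

theorem memL_singleton {n d : ℕ} {X : Finset (Fin n)} (hX : X.card ≤ d) : memL n d {X} :=
  (singL n d X hX).mem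

/-- An element of `L(n,d)` refining and refined by another one equals it. -/
theorem eq_of_refines_of_refines {n d : ℕ} {S T : Coll n} (hS : memL n d S) (hT : memL n d T)
    (h : Refines S T) (h' : Refines T S) : S = T :=
  congrArg L.val (le_antisymm ((le_iff_refines ⟨S, hS⟩ ⟨T, hT⟩).mpr h)
    ((le_iff_refines ⟨T, hT⟩ ⟨S, hS⟩).mpr h'))

theorem rho_le_of_isClosure {n d : ℕ} {H T : Coll n} (hT : memL n d T)
    (hH : ∀ X ∈ H, X.card ≤ d) (h : IsClosure d H T) : rho d T ≤ rho d H := by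
  obtain ⟨S, hS, hHS, hmin, hrho⟩ := exists_closure H hH
  rwa [eq_of_refines_of_refines hT hS (h.2 S hS hHS) (hmin T hT h.1)]

theorem codim_le_card_of_mem_generators {n d : ℕ} {H : Coll n} {X : Finset (Fin n)}
    (hX : X.card ≤ d) (h : H ∈ generators d {X}) : d + 1 - X.card ≤ H.card := by
  rw [mem_generators] at h
  have h1 := rho_le_of_isClosure (memL_singleton hX) (fun Y hY => (h.1 Y hY).le) h.2
  have h2 : rho d H = H.card := by
    rw [rho, Finset.sum_congr rfl fun Y hY => show codim d Y = 1 by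
      unfold codim; rw [h.1 Y hY]; ring]
    simp
  rw [h2, rho_singleton] at h1
  unfold codim at h1
  omega

theorem card_le_one_of_mem_generators {n d : ℕ} {H : Coll n} {X : Finset (Fin n)}
    (hX : X.card = d) (h : H ∈ generators d {X}) : H.card ≤ 1 := by
  rw [mem_generators] at h
  have hsub : H ⊆ {X} := by
    intro Y hY
    rw [Finset.mem_singleton]
    exact (Finset.eq_of_subset_of_card_le (refines_singleton.mp h.2.1 Y hY)
      (by rw [h.1 Y hY, hX])).symm
  simpa using Finset.card_le_card hsub

/-- Distinct members of an element of `L(n,d)` are not contained in a common `d`-element set. -/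
theorem eq_of_subset_of_subset {n d : ℕ} {T : Coll n} (hT : memL n d T) {X Y Z : Finset (Fin n)}
    (hX : X ∈ T) (hY : Y ∈ T) (hZ : Z.card ≤ d) (hXZ : X ⊆ Z) (hYZ : Y ⊆ Z) : X = Y := by
  by_contra hne
  have h1 := hT.1 {X, Y} (by simp [Finset.insert_subset_iff, hX, hY])
    (Finset.card_pair hne).ge
  have h2 : ({X, Y} : Coll n).inf id = X ∩ Y := by simp
  have h3 := Finset.card_union_add_card_inter X Y
  have h4 := Finset.card_le_card (Finset.union_subset hXZ hYZ)
  unfold Dd at h1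
  rw [h2, rho, Finset.sum_pair hne] at h1
  unfold codim at h1
  omega

/-- A generating set of `T` splits into generating sets of the members of `T`. -/
theorem filter_mem_generators {n d : ℕ} {H T : Coll n} (hT : memL n d T)
    (hH : H ∈ generators d T) {X : Finset (Fin n)} (hX : X ∈ T) :
    {Z ∈ H | X ⊆ Z} ∈ generators d {X} := by
  rw [mem_generators] at hH
  obtain ⟨hHd, hHT⟩ := hH
  have hcl : ∀ Y : Finset (Fin n), ∃ S, memL n d S ∧ Refines {Z ∈ H | Y ⊆ Z} S ∧
      ∀ U, memL n d U → Refines {Z ∈ H | Y ⊆ Z} U → Refines S U := by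
    intro Y
    obtain ⟨S, h1, h2, h3, -⟩ := exists_closure (d := d) {Z ∈ H | Y ⊆ Z}
      fun Z hZ => (hHd Z (Finset.mem_filter.mp hZ).1).le
    exact ⟨S, h1, h2, h3⟩
  choose g hg hHg hgmin using hcl
  have hgY : ∀ Y ∈ T, Refines (g Y) {Y} := fun Y hY =>
    hgmin Y _ (memL_singleton (hT.2 Y hY))
      (refines_singleton.mpr fun Z hZ => (Finset.mem_filter.mp hZ).2)
  have hrho : ∀ Y ∈ T, rho d (g Y) ≤ codim d Y := by
    intro Y hY
    rw [← rho_singleton]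
    rcases eq_or_rho_lt_of_refines (hg Y) (memL_singleton (hT.2 Y hY)) (hgY Y hY) with h | h
    · rw [h]
    · exact h.le
  have hcard : ∀ Y ∈ T.biUnion g, Y.card ≤ d := by
    intro Y hY
    obtain ⟨X, -, hYX⟩ := Finset.mem_biUnion.mp hY
    exact (hg X).2 Y hYX
  have hcov : Refines H (T.biUnion g) := by
    intro Z hZ
    obtain ⟨Y, hY, hYZ⟩ := hHT.1 Z hZ
    obtain ⟨W, hW, hWZ⟩ := hHg Y Z (Finset.mem_filter.mpr ⟨hZ, hYZ⟩)
    exact ⟨W, Finset.mem_biUnion.mpr ⟨Y, hY, hW⟩, hWZ⟩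
  have hclT : IsClosure d (T.biUnion g) T := by
    refine ⟨?_, fun U hU h => hHT.2 U hU (hcov.trans h)⟩
    intro W hW
    obtain ⟨Y, hY, hWY⟩ := Finset.mem_biUnion.mp hW
    exact ⟨Y, hY, refines_singleton.mp (hgY Y hY) W hWY⟩
  have h1 := rho_le_of_isClosure hT hcard hclT
  have h2 := rho_biUnion_le (d := d) T g fun Y _ => (hg Y).2
  have h3 : ∑ Y ∈ T, rho d (g Y) = ∑ Y ∈ T, codim d Y :=
    le_antisymm (Finset.sum_le_sum hrho) (h1.trans h2)
  have h4 := (Finset.sum_eq_sum_iff_of_le hrho).mp h3 X hX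
  have h5 : g X = {X} := by
    rcases eq_or_rho_lt_of_refines (hg X) (memL_singleton (hT.2 X hX)) (hgY X hX) with h | h
    · exact h
    · rw [rho_singleton] at h
      omega
  rw [mem_generators]
  refine ⟨fun Z hZ => hHd Z (Finset.mem_filter.mp hZ).1, ?_, ?_⟩
  · rw [← h5]
    exact hHg X
  · rw [← h5]
    exact hgmin X

/-- Generating sets of the members of `T` combine to a generating set of `T`. -/
theorem biUnion_mem_generators {n d : ℕ} {T : Coll n} {g : Finset (Fin n) → Coll n}
    (hg : ∀ X ∈ T, g X ∈ generators d {X}) : T.biUnion g ∈ generators d T := by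
  simp only [mem_generators] at hg ⊢
  refine ⟨?_, ?_, ?_⟩
  · intro Z hZ
    obtain ⟨X, hX, hZX⟩ := Finset.mem_biUnion.mp hZ
    exact (hg X hX).1 Z hZX
  · intro Z hZ
    obtain ⟨X, hX, hZX⟩ := Finset.mem_biUnion.mp hZ
    exact ⟨X, hX, refines_singleton.mp (hg X hX).2.1 Z hZX⟩
  · intro U hU h X hX
    refine singleton_refines.mp ((hg X hX).2.2 U hU ?_)
    exact (Refines.of_subset (Finset.subset_biUnion_of_mem g hX)).trans h

theorem filter_biUnion_eq {n d : ℕ} {T : Coll n} (hT : memL n d T)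
    {g : Finset (Fin n) → Coll n} (hg : ∀ X ∈ T, g X ∈ generators d {X})
    {X : Finset (Fin n)} (hX : X ∈ T) : {Z ∈ T.biUnion g | X ⊆ Z} = g X := by
  simp only [mem_generators] at hg
  ext Z
  rw [Finset.mem_filter, Finset.mem_biUnion]
  constructor
  · rintro ⟨⟨Y, hY, hZ⟩, hXZ⟩
    rwa [eq_of_subset_of_subset hT hX hY ((hg Y hY).1 Z hZ).le hXZ
      (refines_singleton.mp (hg Y hY).2.1 Z hZ)]
  · intro hZ
    exact ⟨⟨X, hX, hZ⟩, refines_singleton.mp (hg X hX).2.1 Z hZ⟩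

theorem card_biUnion_generators {n d : ℕ} {T : Coll n} (hT : memL n d T)
    {g : Finset (Fin n) → Coll n} (hg : ∀ X ∈ T, g X ∈ generators d {X}) :
    (T.biUnion g).card = ∑ X ∈ T, (g X).card := by
  refine Finset.card_biUnion fun X hX Y hY hne => ?_
  simp only [mem_generators] at hg
  refine Finset.disjoint_left.mpr fun Z hZX hZY => ?_
  exact hne (eq_of_subset_of_subset hT hX hY ((hg Y hY).1 Z hZY).le
    (refines_singleton.mp (hg X hX).2.1 Z hZX) (refines_singleton.mp (hg Y hY).2.1 Z hZY))

/-- The families of generating sets of the members of `T`, extended by `∅` off `T`. -/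
noncomputable def generatorFamilies {n : ℕ} (d : ℕ) (T : Coll n) :
    Finset (Finset (Fin n) → Coll n) :=
  Fintype.piFinset fun X => if X ∈ T then generators d {X} else {∅}

theorem mem_generatorFamilies {n d : ℕ} {T : Coll n} {g : Finset (Fin n) → Coll n} :
    g ∈ generatorFamilies d T ↔ (∀ X ∈ T, g X ∈ generators d {X}) ∧ ∀ X ∉ T, g X = ∅ := by
  rw [generatorFamilies, Fintype.mem_piFinset]
  constructor
  · intro h
    refine ⟨fun X hX => ?_, fun X hX => ?_⟩
    · simpa [hX] using h X
    · simpa [hX] using h X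
  · rintro ⟨h1, h2⟩ X
    by_cases hX : X ∈ T
    · simpa [hX] using h1 X hX
    · simpa [hX] using h2 X hX

theorem card_generators_eq_card_families {n d m : ℕ} {T : Coll n} (hT : memL n d T) :
    ((generators d T).filter fun H => H.card = m).card =
      ((generatorFamilies d T).filter fun g => ∑ X ∈ T, (g X).card = m).card := by
  have hback : ∀ H ∈ generators d T,
      (T.biUnion fun X => if X ∈ T then {Z ∈ H | X ⊆ Z} else ∅) = H := by
    intro H hH
    rw [mem_generators] at hH
    ext Z
    rw [Finset.mem_biUnion]
    constructor
    · rintro ⟨X, hX, hZ⟩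
      rw [if_pos hX] at hZ
      exact (Finset.mem_filter.mp hZ).1
    · intro hZ
      obtain ⟨X, hX, hXZ⟩ := hH.2.1 Z hZ
      exact ⟨X, hX, by simp [hX, hZ, hXZ]⟩
  have hfam : ∀ H ∈ generators d T,
      (fun X => if X ∈ T then {Z ∈ H | X ⊆ Z} else ∅) ∈ generatorFamilies d T := by
    intro H hH
    rw [mem_generatorFamilies]
    refine ⟨fun X hX => ?_, fun X hX => if_neg hX⟩
    simp only [if_pos hX]
    exact filter_mem_generators hT hH hX
  refine Finset.card_nbij' (fun H X => if X ∈ T then {Z ∈ H | X ⊆ Z} else ∅)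
    (fun g => T.biUnion g) ?_ ?_ ?_ ?_
  · intro H hH
    simp only [Finset.coe_filter, Set.mem_ofPred_eq] at hH ⊢
    refine ⟨hfam H hH.1, ?_⟩
    rw [← card_biUnion_generators hT (mem_generatorFamilies.mp (hfam H hH.1)).1,
      hback H hH.1, hH.2]
  · intro g hg
    simp only [Finset.coe_filter, Set.mem_ofPred_eq] at hg ⊢
    have hg1 := mem_generatorFamilies.mp hg.1
    exact ⟨biUnion_mem_generators hg1.1, by rw [card_biUnion_generators hT hg1.1, hg.2]⟩
  · intro H hH
    simp only [Finset.coe_filter, Set.mem_ofPred_eq] at hH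
    exact hback H hH.1
  · intro g hg
    simp only [Finset.coe_filter, Set.mem_ofPred_eq] at hg
    have hg1 := mem_generatorFamilies.mp hg.1
    funext X
    by_cases hX : X ∈ T
    · simp only [if_pos hX]
      exact filter_biUnion_eq hT hg1.1 hX
    · simp only [if_neg hX]
      exact (hg1.2 X hX).symm

theorem card_families_of_card_eq {n d : ℕ} {T : Coll n} {f : Finset (Fin n) → ℕ}
    (hf : ∀ X ∉ T, f X = 0) :
    ((generatorFamilies d T).filter fun g => (fun X => (g X).card) = f).card =
      ∏ X ∈ T, ((generators d {X}).filter fun H => H.card = f X).card := by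
  have h : ((generatorFamilies d T).filter fun g => (fun X => (g X).card) = f) =
      Fintype.piFinset fun X =>
        if X ∈ T then (generators d {X}).filter fun H => H.card = f X else {∅} := by
    ext g
    rw [Finset.mem_filter, mem_generatorFamilies, Fintype.mem_piFinset, funext_iff]
    constructor
    · rintro ⟨⟨h1, h2⟩, h3⟩ X
      by_cases hX : X ∈ T
      · simp [hX, h1 X hX, h3 X]
      · simp [hX, h2 X hX]
    · intro h
      refine ⟨⟨fun X hX => ?_, fun X hX => ?_⟩, fun X => ?_⟩
      · have := h X
        rw [if_pos hX, Finset.mem_filter] at this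
        exact this.1
      · simpa [hX] using h X
      · have := h X
        by_cases hX : X ∈ T
        · rw [if_pos hX, Finset.mem_filter] at this
          exact this.2
        · rw [if_neg hX, Finset.mem_singleton] at this
          rw [this, hf X hX, Finset.card_empty]
  rw [h, Fintype.card_piFinset]
  rw [← Finset.prod_subset (Finset.subset_univ T)]
  · exact Finset.prod_congr rfl fun X hX => by rw [if_pos hX]
  · intro X _ hX
    rw [if_neg hX, Finset.card_singleton]

/-- The superset of `Z` obtained by adding to it the image of `A` under `e`; when `e` enumerates
the complement of `Z`, every superset of `Z` arises in this way from exactly one `A`. -/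
def liftSet {n k : ℕ} (Z : Finset (Fin n)) (e : Fin k ↪ Fin n) (A : Finset (Fin k)) :
    Finset (Fin n) := Z ∪ A.map e

section Lift

variable {n k : ℕ} {Z : Finset (Fin n)} {e : Fin k ↪ Fin n}

theorem mem_liftSet_apply (he : Finset.univ.map e = Zᶜ) {A : Finset (Fin k)} {i : Fin k} :
    e i ∈ liftSet Z e A ↔ i ∈ A := by
  have h : e i ∈ Zᶜ := he ▸ Finset.mem_map_of_mem e (Finset.mem_univ i)
  rw [Finset.mem_compl] at h
  simp [liftSet, h]

theorem liftSet_subset_liftSet (he : Finset.univ.map e = Zᶜ) {A B : Finset (Fin k)} :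
    liftSet Z e A ⊆ liftSet Z e B ↔ A ⊆ B := by
  constructor
  · intro h i hi
    exact (mem_liftSet_apply he).mp (h ((mem_liftSet_apply he).mpr hi))
  · intro h
    exact Finset.union_subset_union_right (Finset.map_subset_map.mpr h)

theorem liftSet_injective (he : Finset.univ.map e = Zᶜ) : Function.Injective (liftSet Z e) :=
  fun _ _ h => Finset.Subset.antisymm ((liftSet_subset_liftSet he).mp h.subset)
    ((liftSet_subset_liftSet he).mp h.symm.subset)

theorem card_liftSet (he : Finset.univ.map e = Zᶜ) (A : Finset (Fin k)) :
    (liftSet Z e A).card = Z.card + A.card := by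
  rw [liftSet, Finset.card_union_of_disjoint, Finset.card_map]
  refine Finset.disjoint_of_subset_right (Finset.map_subset_map.mpr (Finset.subset_univ A)) ?_
  rw [he]
  exact disjoint_compl_right

theorem exists_liftSet_eq (he : Finset.univ.map e = Zᶜ) {X : Finset (Fin n)} (h : Z ⊆ X) :
    ∃ A, liftSet Z e A = X := by
  refine ⟨Finset.univ.filter fun i => e i ∈ X, ?_⟩
  ext x
  simp only [liftSet, Finset.mem_union, Finset.mem_map, Finset.mem_filter, Finset.mem_univ,
    true_and]
  constructor
  · rintro (hx | ⟨i, hi, rfl⟩)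
    · exact h hx
    · exact hi
  · intro hx
    by_cases hxZ : x ∈ Z
    · exact Or.inl hxZ
    · have : x ∈ Finset.univ.map e := he ▸ Finset.mem_compl.mpr hxZ
      obtain ⟨i, -, rfl⟩ := Finset.mem_map.mp this
      exact Or.inr ⟨i, hx, rfl⟩

theorem liftSet_empty : liftSet Z e ∅ = Z := by
  simp [liftSet]

theorem subset_liftSet (A : Finset (Fin k)) : Z ⊆ liftSet Z e A :=
  Finset.subset_union_left

theorem exists_image_liftSet_eq (he : Finset.univ.map e = Zᶜ) {S : Coll n}
    (h : ∀ X ∈ S, Z ⊆ X) : ∃ S' : Coll k, S'.image (liftSet Z e) = S := by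
  refine ⟨Finset.univ.filter fun A => liftSet Z e A ∈ S, ?_⟩
  ext X
  simp only [Finset.mem_image, Finset.mem_filter, Finset.mem_univ, true_and]
  constructor
  · rintro ⟨A, hA, rfl⟩
    exact hA
  · intro hX
    obtain ⟨A, rfl⟩ := exists_liftSet_eq he (h X hX)
    exact ⟨A, hX, rfl⟩

theorem codim_liftSet (he : Finset.univ.map e = Zᶜ) {d : ℕ} (hZ : Z.card ≤ d)
    (A : Finset (Fin k)) : codim d (liftSet Z e A) = codim (d - Z.card) A := by
  unfold codim
  rw [card_liftSet he]
  push_cast [Nat.cast_sub hZ]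
  ring

theorem inf_image_liftSet (he : Finset.univ.map e = Zᶜ) (S : Coll k) :
    (S.image (liftSet Z e)).inf id = liftSet Z e (S.inf id) := by
  obtain ⟨A, hA⟩ : ∃ A, liftSet Z e A = (S.image (liftSet Z e)).inf id := by
    refine exists_liftSet_eq he (subset_inf_id.mpr fun X hX => ?_)
    obtain ⟨A, -, rfl⟩ := Finset.mem_image.mp hX
    exact subset_liftSet A
  rw [← hA]
  congr 1
  ext i
  rw [← mem_liftSet_apply he, hA, mem_inf_id, mem_inf_id]
  simp [mem_liftSet_apply he]

theorem Dd_image_liftSet (he : Finset.univ.map e = Zᶜ) {d : ℕ} (hZ : Z.card ≤ d) (S : Coll k) :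
    Dd d (S.image (liftSet Z e)) = Dd (d - Z.card) S := by
  unfold Dd rho
  rw [inf_image_liftSet he, codim_liftSet he hZ,
    Finset.sum_image fun _ _ _ _ h => liftSet_injective he h]
  simp only [codim_liftSet he hZ]

theorem memL_image_liftSet (he : Finset.univ.map e = Zᶜ) {d : ℕ} (hZ : Z.card ≤ d)
    {S : Coll k} : memL n d (S.image (liftSet Z e)) ↔ memL k (d - Z.card) S := by
  have hcard : ∀ V : Coll k, (V.image (liftSet Z e)).card = V.card := fun V =>
    Finset.card_image_of_injective V (liftSet_injective he)
  constructor
  · rintro ⟨h1, h2⟩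
    refine ⟨fun V hV hV2 => ?_, fun A hA => ?_⟩
    · rw [← Dd_image_liftSet he hZ]
      exact h1 _ (Finset.image_subset_image hV) (by rwa [hcard])
    · have := h2 _ (Finset.mem_image_of_mem _ hA)
      rw [card_liftSet he] at this
      omega
  · rintro ⟨h1, h2⟩
    refine ⟨fun V hV hV2 => ?_, fun X hX => ?_⟩
    · obtain ⟨V', hV', rfl⟩ := Finset.subset_image_iff.mp hV
      rw [hcard] at hV2
      rw [Dd_image_liftSet he hZ]
      exact h1 V' hV' hV2
    · obtain ⟨A, hA, rfl⟩ := Finset.mem_image.mp hX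
      have := h2 A hA
      rw [card_liftSet he]
      omega

theorem refines_image_liftSet (he : Finset.univ.map e = Zᶜ) {S T : Coll k} :
    Refines (S.image (liftSet Z e)) (T.image (liftSet Z e)) ↔ Refines S T := by
  simp [Refines, liftSet_subset_liftSet he]

theorem image_liftSet_mem_generators (he : Finset.univ.map e = Zᶜ) {d : ℕ} (hZ : Z.card ≤ d)
    {H : Coll k} :
    H.image (liftSet Z e) ∈ generators d {Z} ↔ H ∈ generators (d - Z.card) {∅} := by
  have hZimg : ({∅} : Coll k).image (liftSet Z e) = {Z} := by simp [liftSet_empty]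
  rw [mem_generators, mem_generators]
  have hcard : (∀ X ∈ H.image (liftSet Z e), X.card = d) ↔ ∀ X ∈ H, X.card = d - Z.card := by
    simp only [Finset.forall_mem_image, card_liftSet he]
    exact forall₂_congr fun X _ => by omega
  rw [hcard]
  refine and_congr_right fun hHd => ?_
  have hHZ : Refines (H.image (liftSet Z e)) {Z} := by
    rw [← hZimg, refines_image_liftSet he]
    exact refines_singleton.mpr fun _ _ => Finset.empty_subset _
  constructor
  · intro h
    refine ⟨refines_singleton.mpr fun _ _ => Finset.empty_subset _, fun U hU hHU => ?_⟩
    rw [← refines_image_liftSet he, hZimg]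
    exact h.2 _ ((memL_image_liftSet he hZ).mpr hU) ((refines_image_liftSet he).mpr hHU)
  · intro h
    refine ⟨hHZ, fun U hU hHU => ?_⟩
    obtain ⟨S, hS, hHS, hmin, -⟩ :=
      exists_closure (d := d) (H.image (liftSet Z e)) fun X hX => (hcard.mpr hHd X hX).le
    obtain ⟨S', rfl⟩ := exists_image_liftSet_eq he
      (refines_singleton.mp (hmin _ (memL_singleton hZ) hHZ))
    refine Refines.trans ?_ (hmin U hU hHU)
    rw [← hZimg, refines_image_liftSet he]
    exact h.2 S' ((memL_image_liftSet he hZ).mp hS) ((refines_image_liftSet he).mp hHS)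

end Lift

theorem card_generators_singleton {n d m : ℕ} {Z : Finset (Fin n)} (hZ : Z.card ≤ d) :
    ((generators d {Z}).filter fun H => H.card = m).card =
      kappa (n - Z.card) (d - Z.card) m (Ltop (n - Z.card) (d - Z.card)) := by
  have hcardZ : Zᶜ.card = n - Z.card := by rw [Finset.card_compl, Fintype.card_fin]
  let e : Fin (n - Z.card) ↪ Fin n := (Zᶜ.orderEmbOfFin hcardZ).toEmbedding
  have he : Finset.univ.map e = Zᶜ := Finset.map_orderEmbOfFin_univ _ hcardZ
  have hinj := liftSet_injective he
  rw [kappa_eq_card]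
  symm
  refine Finset.card_nbij (fun H => H.image (liftSet Z e)) ?_ ?_ ?_
  · intro H hH
    simp only [Finset.coe_filter, Set.mem_ofPred_eq] at hH ⊢
    exact ⟨(image_liftSet_mem_generators he hZ).mpr hH.1,
      by rw [Finset.card_image_of_injective _ hinj, hH.2]⟩
  · exact (Finset.image_injective hinj).injOn
  · intro H hH
    simp only [Finset.coe_filter, Set.mem_ofPred_eq] at hH
    obtain ⟨H', rfl⟩ := exists_image_liftSet_eq he
      (refines_singleton.mp (mem_generators.mp hH.1).2.1)
    rw [image_liftSet_mem_generators he hZ, Finset.card_image_of_injective _ hinj] at hH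
    refine ⟨H', ?_, rfl⟩
    simp only [Finset.coe_filter, Set.mem_ofPred_eq]
    exact hH

/-- For `T = {T_1,…,T_l} ∈ L(n,d)` with `l ≥ 1`, `T ≠ {∅}`, and
`m ≥ 1`, `κ_{n,d}(m,T) = Σ_{(m_1,…,m_l) ∈ M(m,T)} ∏_i κ_{n−|T_i|,d−|T_i|}(m_i, ⊤)`,
where `M(m,T)` is the set of tuples `(m_i)` of positive integers (encoded as
functions on members of `T`, vanishing off `T`) with `m_i ≥ codim_d(T_i)`,
`m_i = 1` whenever `codim_d(T_i) = 1`, and `Σ m_i = m`, and `⊤ = {∅}` is the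
maximum of `L(n−|T_i|, d−|T_i|)`. -/
theorem kappa_recursion (n d : ℕ) (hd : 1 ≤ d) (hnd : d < n)
    (T : L n d) (hT : T.val.Nonempty) (hTtop : T ≠ Ltop n d) (m : ℕ) (hm : 1 ≤ m) :
    kappa n d m T =
      ∑ᶠ f ∈ {f : Finset (Fin n) → ℕ |
          (∀ X ∉ T.val, f X = 0) ∧
          (∀ X ∈ T.val,
            1 ≤ f X ∧ d + 1 - X.card ≤ f X ∧ (d + 1 - X.card = 1 → f X = 1)) ∧
          (∑ X ∈ T.val, f X = m)},
        ∏ X ∈ T.val,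
          kappa (n - X.card) (d - X.card) (f X)
            (Ltop (n - X.card) (d - X.card)) := by
  let F : Set (Finset (Fin n) → ℕ) := {f : Finset (Fin n) → ℕ |
          (∀ X ∉ T.val, f X = 0) ∧
          (∀ X ∈ T.val,
            1 ≤ f X ∧ d + 1 - X.card ≤ f X ∧ (d + 1 - X.card = 1 → f X = 1)) ∧
          (∑ X ∈ T.val, f X = m)}
  have hFfin : F.Finite := by
    refine (Set.Finite.pi' fun _ : Finset (Fin n) => Set.finite_Iic m).subset ?_
    rintro f ⟨h1, -, h3⟩ X
    by_cases hX : X ∈ T.val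
    · exact h3 ▸ Finset.single_le_sum (f := f) (fun _ _ => Nat.zero_le _) hX
    · simp [h1 X hX]
  rw [finsum_mem_eq_finite_toFinset_sum _ hFfin, kappa_eq_card,
    card_generators_eq_card_families T.mem,
    Finset.card_eq_sum_card_fiberwise (f := fun g X => (g X).card) (t := hFfin.toFinset)]
  · refine Finset.sum_congr rfl fun f hf => ?_
    rw [Set.Finite.mem_toFinset] at hf
    rw [Finset.filter_filter, ← Finset.prod_congr rfl fun X hX =>
      card_generators_singleton (m := f X) (T.mem.2 X hX), ← card_families_of_card_eq hf.1]
    congr 1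
    refine Finset.filter_congr fun g _ => and_iff_right_of_imp ?_
    rintro rfl
    exact hf.2.2
  · intro g hg
    simp only [Finset.coe_filter, Set.mem_ofPred_eq] at hg
    obtain ⟨hg1, hg2⟩ := mem_generatorFamilies.mp hg.1
    rw [Set.Finite.coe_toFinset]
    refine ⟨fun X hX => by simp [hg2 X hX], fun X hX => ?_, hg.2⟩
    have h1 := codim_le_card_of_mem_generators (T.mem.2 X hX) (hg1 X hX)
    have h2 := T.mem.2 X hX
    have h3 : 1 ≤ (g X).card := by omega
    exact ⟨h3, h1, fun h =>
      (card_le_one_of_mem_generators (by omega) (hg1 X hX)).antisymm h3⟩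
end

section
/- Let n ≥ 3 and m ≥ 3. Then κ_{n,2}(m, ⊤) = C(C(n,2), m) − n · C(n−1, m), where ⊤ = {∅} is the maximum element of L(n,2) and C(a,b) denotes the binomial coefficient. Equivalently, the number of m-element sets of 2-element subsets of {1,…,n} whose corresponding hyperplanes of L(n,2) have least upper bound ⊤ equals C(C(n,2), m) minus n·C(n−1, m), the latter counting the m-sets of 2-element subsets sharing a common element. -/
attribute [local instance] Classical.propDecidable

lemma codim_le {n : ℕ} (d : ℕ) (X : Finset (Fin n)) : codim d X ≤ d + 1 := by
  unfold codim
  omega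

lemma one_le_codim {n d : ℕ} {X : Finset (Fin n)} (hX : X.card ≤ d) : 1 ≤ codim d X := by
  unfold codim
  omega

lemma rho_lt_of_memL {n d : ℕ} {T : Coll n} (hT : memL n d T) (h2 : 2 ≤ T.card) :
    rho d T < d + 1 := by
  have h := hT.1 T subset_rfl h2
  have h' := codim_le d (T.inf id)
  unfold Dd at h
  omega

lemma card_le_rho {n d : ℕ} {T : Coll n} (hT : ∀ X ∈ T, X.card ≤ d) : (T.card : ℤ) ≤ rho d T := by
  unfold rho
  simpa using Finset.card_nsmul_le_sum T (codim d) 1 fun X hX => one_le_codim (hT X hX)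

/-- If every member of a set of at least three pairs contains a member of `T ∈ L(n,2)`, then
`T = ⊤` unless the pairs share an element. -/
lemma eq_Ltop_of_covers {n : ℕ} {H : Coll n} (hH : 3 ≤ H.card) (hpair : ∀ X ∈ H, X.card = 2)
    (hstar : ¬ ∃ i, ∀ X ∈ H, i ∈ X) {T : L n 2} (hT : ∀ X ∈ H, ∃ Y ∈ T.val, Y ⊆ X) :
    T = Ltop n 2 := by
  obtain ⟨T, hmem⟩ := T
  simp only at hT
  suffices h : T = {∅} by subst h; rfl
  have hrho : ∀ Y ∈ T, codim 2 Y + ((T.card : ℤ) - 1) ≤ rho 2 T := by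
    intro Y hY
    have h := card_le_rho (d := 2) (T := T.erase Y)
      fun X hX => hmem.2 X (Finset.mem_of_mem_erase hX)
    have hs : codim 2 Y + rho 2 (T.erase Y) = rho 2 T := Finset.add_sum_erase T (codim 2) hY
    have hc := Finset.card_erase_add_one hY
    omega
  by_cases h2 : 2 ≤ T.card
  · exfalso
    have hlt := rho_lt_of_memL hmem h2
    push_cast at hlt
    have hsub : H ⊆ T := by
      intro X hX
      obtain ⟨Y, hY, hYX⟩ := hT X hX
      have h := hrho Y hY
      unfold codim at h
      have hXc := hpair X hX
      have hYc : X.card ≤ Y.card := by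
        push_cast at h
        omega
      rwa [← Finset.eq_of_subset_of_card_le hYX hYc]
    have h := Finset.card_le_card hsub
    have h' := card_le_rho hmem.2
    omega
  · obtain ⟨X, hX⟩ := Finset.card_pos.1 (by omega : 0 < H.card)
    obtain ⟨Y, hY, -⟩ := hT X hX
    have hTY : T = {Y} :=
      (Finset.eq_of_subset_of_card_le (Finset.singleton_subset_iff.2 hY)
        (by rw [Finset.card_singleton]; omega)).symm
    subst hTY
    rcases Y.eq_empty_or_nonempty with rfl | ⟨i, hi⟩
    · rfl
    · refine absurd ⟨i, fun X hX => ?_⟩ hstar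
      obtain ⟨Z, hZ, hZX⟩ := hT X hX
      rw [Finset.mem_singleton] at hZ
      exact hZX (hZ ▸ hi)

lemma le_of_singletons {n : ℕ} {S : L n 2} {X Y : Finset (Fin n)} {T : L n 2} (hS : S.val = {X})
    (hT : T.val = {Y}) (hYX : Y ⊆ X) (hlt : Y.card < X.card) : S ≤ T := by
  refine Or.inr ⟨?_, ?_⟩
  · rw [hS, hT]
    simp only [rho, Finset.sum_singleton, codim]
    omega
  · rw [hS, hT]
    simpa using hYX

/-- The hyperplanes of at least three pairs have supremum `⊤` iff the pairs have no common
element. -/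
lemma isLUB_Ltop_iff {n : ℕ} {H : Coll n} (hH : 3 ≤ H.card) (hpair : ∀ X ∈ H, X.card = 2) :
    IsLUB {S : L n 2 | ∃ X ∈ H, S.val = {X}} (Ltop n 2) ↔ ¬ ∃ i, ∀ X ∈ H, i ∈ X := by
  constructor
  · rintro hlub ⟨i, hi⟩
    have hub : singL n 2 {i} (by simp) ∈ upperBounds {S : L n 2 | ∃ X ∈ H, S.val = {X}} := by
      rintro S ⟨X, hX, hS⟩
      refine le_of_singletons hS rfl (by simpa using hi X hX) ?_
      rw [hpair X hX]
      simp
    rcases hlub.2 hub with h | ⟨h, -⟩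
    · have h' := congrArg L.val h
      simp [Ltop, singL] at h'
    · simp [Ltop, singL, rho, codim] at h
  · intro hstar
    constructor
    · rintro S ⟨X, hX, hS⟩
      refine le_of_singletons hS rfl (Finset.empty_subset X) ?_
      rw [hpair X hX]
      simp
    · intro T hT
      refine (eq_Ltop_of_covers hH hpair hstar fun X hX => ?_).ge
      have hS : singL n 2 X (hpair X hX).le ≤ T := hT ⟨X, hX, rfl⟩
      rcases hS with h | ⟨-, h⟩
      · exact ⟨X, by rw [← h]; simp [singL], subset_rfl⟩
      · exact h X (by simp [singL])

lemma card_pairs_containing {n : ℕ} (i : Fin n) :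
    ((Finset.powersetCard 2 Finset.univ).filter (fun X : Finset (Fin n) => i ∈ X)).card
      = n - 1 := by
  have himage : (Finset.powersetCard 2 Finset.univ).filter (fun X : Finset (Fin n) => i ∈ X)
      = (Finset.univ.erase i).image (fun j => {i, j}) := by
    ext X
    simp only [Finset.mem_filter, Finset.mem_powersetCard, Finset.subset_univ, true_and,
      Finset.mem_image, Finset.mem_erase, Finset.mem_univ, and_true]
    constructor
    · rintro ⟨hX, hi⟩
      obtain ⟨a, b, hab, rfl⟩ := Finset.card_eq_two.1 hX
      rcases (by simpa using hi : i = a ∨ i = b) with rfl | rfl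
      · exact ⟨b, hab.symm, rfl⟩
      · exact ⟨a, hab, Finset.pair_comm _ _⟩
    · rintro ⟨j, hj, rfl⟩
      exact ⟨Finset.card_pair hj.symm, by simp⟩
  rw [himage, Finset.card_image_of_injOn, Finset.card_erase_of_mem (Finset.mem_univ i),
    Finset.card_univ, Fintype.card_fin]
  intro a ha b hb hab
  have hmem : a ∈ ({i, b} : Finset (Fin n)) := by
    have h : ({i, a} : Finset (Fin n)) = {i, b} := hab
    rw [← h]
    simp
  have hne : a ≠ i := by simpa using ha
  simpa [hne] using hmem

/-- A pair containing distinct `i` and `j` equals `{i, j}`. -/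
lemma eq_of_two_common {n : ℕ} {i j : Fin n} {X : Finset (Fin n)} (hij : i ≠ j)
    (hX : X.card = 2) (hi : i ∈ X) (hj : j ∈ X) : X = {i, j} := by
  refine (Finset.eq_of_subset_of_card_le (fun k hk => ?_) ?_).symm
  · rcases (by simpa using hk : k = i ∨ k = j) with rfl | rfl <;> assumption
  · rw [Finset.card_pair hij, hX]

/-- For `n ≥ 3` and `m ≥ 3`,
`κ_{n,2}(m, ⊤) = C(C(n,2), m) − n·C(n−1, m)`, where `⊤ = {∅}` is the maximum
element of `L(n,2)`. -/
theorem kappa_top_dim_two (n m : ℕ) (hn : 3 ≤ n) (hm : 3 ≤ m) :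
    (kappa n 2 m (Ltop n 2) : ℤ) =
      (Nat.choose (Nat.choose n 2) m : ℤ) - (n : ℤ) * (Nat.choose (n - 1) m : ℤ) := by
  set P : Coll n := Finset.powersetCard 2 Finset.univ with hP
  let star (i : Fin n) : Finset (Coll n) := Finset.powersetCard m (P.filter (fun X => i ∈ X))
  have hstars : (Finset.univ.biUnion star).card = n * (n - 1).choose m := by
    rw [Finset.card_biUnion]
    · simp [star, hP, card_pairs_containing]
    · intro i _ j _ hij
      refine Finset.disjoint_left.2 fun H hi hj => ?_
      simp only [star, Finset.mem_powersetCard] at hi hj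
      have hsub : H ⊆ {{i, j}} := by
        intro X hX
        have h1 := Finset.mem_filter.1 (hi.1 hX)
        have h2 := Finset.mem_filter.1 (hj.1 hX)
        exact Finset.mem_singleton.2
          (eq_of_two_common hij (Finset.mem_powersetCard.1 h1.1).2 h1.2 h2.2)
      have h := Finset.card_le_card hsub
      rw [Finset.card_singleton] at h
      omega
  have hsub : Finset.univ.biUnion star ⊆ Finset.powersetCard m P :=
    Finset.biUnion_subset.2 fun i _ => Finset.powersetCard_mono (Finset.filter_subset _ _)
  have hkappa : kappa n 2 m (Ltop n 2) =
      (Finset.powersetCard m P \ Finset.univ.biUnion star).card := by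
    unfold kappa
    congr 1
    ext H
    simp only [Finset.mem_filter, Finset.mem_univ, true_and, Finset.mem_sdiff,
      Finset.mem_biUnion, star, Finset.mem_powersetCard, hP, Finset.subset_iff]
    constructor
    · rintro ⟨hc, hpair, hlub⟩
      refine ⟨⟨fun X hX => ⟨fun _ _ => trivial, hpair X hX⟩, hc⟩, ?_⟩
      rintro ⟨i, hi, -⟩
      exact (isLUB_Ltop_iff (by omega) hpair).1 hlub ⟨i, fun X hX => (hi hX).2⟩
    · rintro ⟨⟨hpair, hc⟩, hstar⟩
      have hpair' : ∀ X ∈ H, X.card = 2 := fun X hX => (hpair hX).2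
      refine ⟨hc, hpair', (isLUB_Ltop_iff (by omega) hpair').2 ?_⟩
      rintro ⟨i, hi⟩
      exact hstar ⟨i, fun X hX => ⟨hpair hX, hi X hX⟩, hc⟩
  have hadd := Finset.card_sdiff_add_card_eq_card hsub
  rw [← hkappa, hstars, Finset.card_powersetCard, hP, Finset.card_powersetCard,
    Finset.card_univ, Fintype.card_fin] at hadd
  rw [← hadd]
  push_cast
  ring
end

section
/- Let n ≥ 3. Then μ_{n,2}(⊤) = −3·C(n,4) − C(n,2) + n − 1, where ⊤ = {∅} is the maximum element of the poset L(n,2), μ_{n,2}(⊤) = μ_{n,2}(∅, ⊤) is the Möbius function value from the minimum element, and C(a,b) denotes the binomial coefficient (equal to 0 when b > a). -/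
attribute [local instance] Classical.propDecidable

theorem codim_two_pos {n : ℕ} {X : Finset (Fin n)} (hX : X.card ≤ 2) : 0 < codim 2 X := by
  unfold codim; omega

theorem rho_empty {n d : ℕ} : rho d (∅ : Coll n) = 0 := by simp [rho]

theorem rho_pair {n d : ℕ} {X Y : Finset (Fin n)} (h : X ≠ Y) :
    rho d {X, Y} = codim d X + codim d Y := by
  simp [rho, Finset.sum_pair h]

theorem Dd_pair {n d : ℕ} {X Y : Finset (Fin n)} (h : X ≠ Y) :
    Dd d {X, Y} = codim d (X ∩ Y) - (codim d X + codim d Y) := by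
  simp [Dd, rho_pair h, Finset.inf_insert, Finset.inf_singleton]

/-- Two distinct members of a collection in `L(n,2)` are disjoint pairs. -/
theorem memL.card_eq_two_and_disjoint {n : ℕ} {T : Coll n} (hT : memL n 2 T)
    {X Y : Finset (Fin n)} (hX : X ∈ T) (hY : Y ∈ T) (h : X ≠ Y) :
    X.card = 2 ∧ Y.card = 2 ∧ Disjoint X Y := by
  have hD := hT.1 {X, Y} (by simp [Finset.insert_subset_iff, hX, hY]) (by rw [Finset.card_pair h])
  have h1 := hT.2 X hX
  have h2 := hT.2 Y hY
  rw [Dd_pair h] at hD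
  unfold codim at hD
  rw [Finset.disjoint_iff_inter_eq_empty, ← Finset.card_eq_zero]
  omega

theorem Finset.ne_of_disjoint_of_card_eq_two {α : Type*} {X Y : Finset α} (hX : X.card = 2)
    (h : Disjoint X Y) : X ≠ Y := by
  rintro rfl
  rw [disjoint_self] at h
  simp [h] at hX

theorem memL_pair_s17 {n : ℕ} {X Y : Finset (Fin n)} (hX : X.card = 2) (hY : Y.card = 2)
    (h : Disjoint X Y) : memL n 2 {X, Y} := by
  have hne := Finset.ne_of_disjoint_of_card_eq_two hX h
  refine ⟨fun T' hT' h2 => ?_, ?_⟩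
  · have : T' = {X, Y} :=
      Finset.eq_of_subset_of_card_le hT' (by rw [Finset.card_pair hne]; exact h2)
    rw [this, Dd_pair hne, Finset.disjoint_iff_inter_eq_empty.mp h]
    simp [codim, hX, hY]
  · simp [hX, hY]

/-- The members of `L(n,2)`: the empty collection, the singletons and the pairs of disjoint
two-element sets. -/
theorem memL_two_iff {n : ℕ} {T : Coll n} :
    memL n 2 T ↔ T = ∅ ∨ (∃ X : Finset (Fin n), X.card ≤ 2 ∧ T = {X}) ∨
      ∃ X Y : Finset (Fin n), X.card = 2 ∧ Y.card = 2 ∧ Disjoint X Y ∧ T = {X, Y} := by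
  constructor
  · intro hT
    rcases T.eq_empty_or_nonempty with h | ⟨X, hX⟩
    · exact Or.inl h
    right
    by_cases hall : ∀ Y ∈ T, Y = X
    · exact Or.inl ⟨X, hT.2 X hX, Finset.eq_singleton_iff_unique_mem.mpr ⟨hX, hall⟩⟩
    right
    push Not at hall
    obtain ⟨Y, hY, hne⟩ := hall
    obtain ⟨h1, h2, h3⟩ := hT.card_eq_two_and_disjoint hX hY hne.symm
    refine ⟨X, Y, h1, h2, h3, ?_⟩
    ext Z
    simp only [Finset.mem_insert, Finset.mem_singleton]
    constructor
    · intro hZ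
      by_contra! hcon
      have hD := hT.1 {Z, X, Y} (by simp [Finset.insert_subset_iff, hX, hY, hZ])
        (by rw [Finset.card_insert_of_notMem (by simp [hcon]), Finset.card_pair hne.symm]; omega)
      have hc := (hT.card_eq_two_and_disjoint hZ hX hcon.1).1
      rw [Dd, rho, Finset.sum_insert (by simp [hcon]), Finset.sum_pair hne.symm] at hD
      simp only [codim, h1, h2, hc] at hD
      omega
    · rintro (rfl | rfl) <;> assumption
  · rintro (rfl | ⟨X, hX, rfl⟩ | ⟨X, Y, hX, hY, h, rfl⟩)
    · exact (Lbot n 2).mem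
    · exact (singL n 2 X hX).mem
    · exact memL_pair_s17 hX hY h

/-- The collections formed by two disjoint two-element sets. -/
noncomputable def disjointPairs (n : ℕ) : Finset (Coll n) :=
  {T | ∃ X Y : Finset (Fin n), X.card = 2 ∧ Y.card = 2 ∧ Disjoint X Y ∧ T = {X, Y}}

theorem card_disjointPairs (n : ℕ) : (disjointPairs n).card = 3 * n.choose 4 := by
  have key := Finset.sum_card_bipartiteAbove_eq_sum_card_bipartiteBelow
    (s := Finset.powersetCard 2 (Finset.univ : Finset (Fin n))) (t := disjointPairs n)
    (fun X T => X ∈ T)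
  have habove : ∀ X ∈ Finset.powersetCard 2 (Finset.univ : Finset (Fin n)),
      (Finset.bipartiteAbove (fun X T => X ∈ T) (disjointPairs n) X).card
        = (n - 2).choose 2 := by
    intro X hX
    have hX2 := (Finset.mem_powersetCard.mp hX).2
    have : Finset.bipartiteAbove (fun X T => X ∈ T) (disjointPairs n) X
        = (Finset.powersetCard 2 Xᶜ).image (fun Y => ({X, Y} : Coll n)) := by
      ext T
      simp only [Finset.mem_bipartiteAbove, disjointPairs, Finset.mem_filter, Finset.mem_univ,
        true_and, Finset.mem_image, Finset.mem_powersetCard, Finset.subset_compl_iff_disjoint_right]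
      constructor
      · rintro ⟨⟨A, B, hA, hB, hAB, rfl⟩, hXT⟩
        simp only [Finset.mem_insert, Finset.mem_singleton] at hXT
        rcases hXT with rfl | rfl
        · exact ⟨B, ⟨hAB.symm, hB⟩, rfl⟩
        · exact ⟨A, ⟨hAB, hA⟩, Finset.pair_comm _ _⟩
      · rintro ⟨Y, ⟨hXY, hY⟩, rfl⟩
        exact ⟨⟨X, Y, hX2, hY, hXY.symm, rfl⟩, by simp⟩
    rw [this, Finset.card_image_of_injOn, Finset.card_powersetCard, Finset.card_compl, hX2,
      Fintype.card_fin]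
    intro Y hY Z hZ hYZ
    simp only [Finset.mem_coe, Finset.mem_powersetCard, Finset.subset_compl_iff_disjoint_right] at hY hZ
    have hmem : Y ∈ ({X, Z} : Coll n) := by
      rw [← show ({X, Y} : Coll n) = {X, Z} from hYZ]; simp
    simp only [Finset.mem_insert, Finset.mem_singleton] at hmem
    exact hmem.resolve_left (Finset.ne_of_disjoint_of_card_eq_two hY.2 hY.1)
  have hbelow : ∀ T ∈ disjointPairs n,
      (Finset.bipartiteBelow (fun X T => X ∈ T)
        (Finset.powersetCard 2 (Finset.univ : Finset (Fin n))) T).card = 2 := by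
    intro T hT
    simp only [disjointPairs, Finset.mem_filter, Finset.mem_univ, true_and] at hT
    obtain ⟨X, Y, hX, hY, hXY, rfl⟩ := hT
    have : Finset.bipartiteBelow (fun X T => X ∈ T)
        (Finset.powersetCard 2 (Finset.univ : Finset (Fin n))) ({X, Y} : Coll n) = {X, Y} := by
      ext Z
      simp only [Finset.mem_bipartiteBelow, Finset.mem_powersetCard, Finset.subset_univ, true_and,
        Finset.mem_insert, Finset.mem_singleton, and_iff_right_iff_imp]
      rintro (rfl | rfl) <;> assumption
    rw [this, Finset.card_pair (Finset.ne_of_disjoint_of_card_eq_two hX hXY)]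
  rw [Finset.sum_congr rfl habove, Finset.sum_congr rfl hbelow] at key
  simp only [Finset.sum_const, smul_eq_mul, Finset.card_powersetCard, Finset.card_univ,
    Fintype.card_fin] at key
  have hmul := Nat.choose_mul (n := n) (show 2 ≤ 4 by norm_num)
  rw [show Nat.choose 4 2 = 6 from rfl] at hmul
  simp only [Nat.reduceSub] at hmul
  omega

/-- The value at `T` of the function `g` on `L(n,d)`, extended by zero to all collections. -/
noncomputable def extendZero {n d : ℕ} (g : L n d → ℤ) (T : Coll n) : ℤ :=
  if h : memL n d T then g ⟨T, h⟩ else 0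

theorem extendZero_val {n d : ℕ} (g : L n d → ℤ) (T : L n d) : extendZero g T.val = g T := by
  simp [extendZero, T.mem]

theorem L.ext_val {n d : ℕ} {S T : L n d} (h : S.val = T.val) : S = T := by
  cases S; cases T; simpa using h

theorem Lbot_lt {n d : ℕ} {B : L n d} (h : 0 < rho d B.val) : Lbot n d < B := by
  refine lt_of_le_of_ne (Or.inr ⟨by simpa [Lbot, rho] using h, by simp [Lbot]⟩) ?_
  rintro rfl
  simp [Lbot, rho] at h

/-- The vanishing of the sum of `g` over a lower interval, with the interval listed explicitly
as a finite set of collections. -/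
theorem sum_extendZero_eq_zero {n d : ℕ} {g : L n d → ℤ} {B : L n d}
    (hB : 0 < rho d B.val)
    (hg : ∑ S ∈ Finset.univ.filter (fun S : L n d => Lbot n d ≤ S ∧ S ≤ B), g S = 0)
    (hpos : ∀ T : L n d, T.val ≠ ∅ → 0 < rho d T.val)
    (E : Finset (Coll n))
    (hE : ∀ T, memL n d T → (T ∈ E ↔
      T = B.val ∨ (rho d T < rho d B.val ∧ ∀ X ∈ T, ∃ Y ∈ B.val, Y ⊆ X)))
    (hEL : ∀ T ∈ E, memL n d T) :
    ∑ T ∈ E, extendZero g T = 0 := by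
  rw [← hg]
  symm
  refine Finset.sum_bij (fun S _ => S.val) ?_ (fun _ _ _ _ h => L.ext_val h) ?_
    (fun S _ => (extendZero_val g S).symm)
  · intro S hS
    simp only [Finset.mem_filter, Finset.mem_univ, true_and] at hS
    rw [hE _ S.mem]
    rcases hS.2 with rfl | h
    · exact Or.inl rfl
    · exact Or.inr h
  · intro T hT
    refine ⟨⟨T, hEL T hT⟩, ?_, rfl⟩
    simp only [Finset.mem_filter, Finset.mem_univ, true_and]
    constructor
    · by_cases h : T = ∅
      · exact Or.inl (L.ext_val h.symm)
      · exact (Lbot_lt (hpos ⟨T, hEL T hT⟩ h)).le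
    · rcases (hE T (hEL T hT)).mp hT with h | h
      · exact Or.inl (L.ext_val h)
      · exact Or.inr h

theorem rho_two_pos {n : ℕ} (T : L n 2) (hT : T.val ≠ ∅) : 0 < rho 2 T.val :=
  Finset.sum_pos (fun X hX => codim_two_pos (T.mem.2 X hX)) (Finset.nonempty_iff_ne_empty.mpr hT)

/-- For `n ≥ 3`, `μ_{n,2}(⊤) = −3·C(n,4) − C(n,2) + n − 1`, where
`⊤ = {∅}` is the maximum element of `L(n,2)` and `μ_{n,2}` is the Möbius
function of `L(n,2)` (characterized by `μ(T,T) = 1` and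
`Σ_{S : T ≤ S ≤ T'} μ(T,S) = 0` for `T < T'`), evaluated from the minimum `∅`. -/
theorem mobius_top_dim_two (n : ℕ) (hn : 3 ≤ n)
    (μ : L n 2 → L n 2 → ℤ)
    (hrefl : ∀ A : L n 2, μ A A = 1)
    (hrec : ∀ A B : L n 2, A < B →
      ∑ S ∈ Finset.univ.filter (fun S : L n 2 => A ≤ S ∧ S ≤ B), μ A S = 0) :
    μ (Lbot n 2) (Ltop n 2) =
      -3 * (Nat.choose n 4 : ℤ) - (Nat.choose n 2 : ℤ) + (n : ℤ) - 1 := by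
  set f : Coll n → ℤ := extendZero (μ (Lbot n 2)) with hf
  have lower : ∀ (B : L n 2) (E : Finset (Coll n)), B.val ≠ ∅ →
      (∀ T ∈ E, memL n 2 T) →
      (∀ T, memL n 2 T → (T ∈ E ↔
        T = B.val ∨ (rho 2 T < rho 2 B.val ∧ ∀ X ∈ T, ∃ Y ∈ B.val, Y ⊆ X))) →
      ∑ T ∈ E, f T = 0 := fun B E hB hEL hE =>
    sum_extendZero_eq_zero (rho_two_pos B hB) (hrec _ B (Lbot_lt (rho_two_pos B hB)))
      rho_two_pos E hE hEL
  have f_empty : f ∅ = 1 := by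
    rw [← hrefl (Lbot n 2)]; exact extendZero_val _ (Lbot n 2)
  have f_two : ∀ X : Finset (Fin n), X.card = 2 → f {X} = -1 := by
    intro X hX
    have := lower (singL n 2 X hX.le) {∅, {X}} (by simp [singL])
      (by
        simp only [Finset.mem_insert, Finset.mem_singleton]
        rintro T (rfl | rfl)
        exacts [(Lbot n 2).mem, (singL n 2 X hX.le).mem])
      (by
        intro T hT
        simp only [Finset.mem_insert, Finset.mem_singleton, singL]
        constructor
        · rintro (rfl | rfl)
          · right; simp [rho_empty, rho_singleton, codim, hX]
          · exact Or.inl rfl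
        · rintro (h | ⟨h, -⟩)
          · exact Or.inr h
          · left
            by_contra hne
            have := rho_two_pos ⟨T, hT⟩ hne
            simp only [rho_singleton, codim, hX] at h this
            omega)
    rw [Finset.sum_pair (by simp), f_empty] at this
    linarith
  have f_one : ∀ i : Fin n, f {{i}} = n - 2 := by
    intro i
    have hpair : ∀ j ∈ Finset.univ.erase i, ({i, j} : Finset (Fin n)).card = 2 := fun j hj =>
      Finset.card_pair (Finset.ne_of_mem_erase hj).symm
    have := lower (singL n 2 {i} (by simp))
      (insert ∅ (insert {{i}} ((Finset.univ.erase i).image fun j => ({{i, j}} : Coll n))))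
      (by simp [singL])
      (by
        simp only [Finset.mem_insert, Finset.mem_image]
        rintro T (rfl | rfl | ⟨j, hj, rfl⟩)
        exacts [(Lbot n 2).mem, (singL n 2 {i} (by simp)).mem,
          (singL n 2 {i, j} (hpair j hj).le).mem])
      (by
        intro T hT
        simp only [Finset.mem_insert, Finset.mem_image, singL]
        constructor
        · rintro (rfl | rfl | ⟨j, hj, rfl⟩)
          · right; simp [rho_empty, rho_singleton, codim]
          · exact Or.inl rfl
          · right
            simp [rho_singleton, codim, hpair j hj]
        · rintro (h | ⟨h, hsub⟩)
          · exact Or.inr (Or.inl h)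
          · rcases memL_two_iff.mp hT with rfl | ⟨X, hX, rfl⟩ | ⟨X, Y, hX, hY, hXY, rfl⟩
            · exact Or.inl rfl
            · right; right
              simp only [rho_singleton, codim, Finset.card_singleton] at h
              have hX2 : X.card = 2 := by omega
              simp only [Finset.mem_singleton, forall_eq, exists_eq_left,
                Finset.singleton_subset_iff] at hsub
              have herase : (X.erase i).card = 1 := by rw [Finset.card_erase_of_mem hsub, hX2]
              obtain ⟨j, hj⟩ := Finset.card_eq_one.mp herase
              refine ⟨j, ?_, ?_⟩
              · have : j ∈ X.erase i := by rw [hj]; simp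
                simpa using Finset.ne_of_mem_erase this
              · rw [← hj, Finset.insert_erase hsub]
            · rw [rho_pair (Finset.ne_of_disjoint_of_card_eq_two hX hXY)] at h
              simp only [rho_singleton, codim, Finset.card_singleton, hX, hY] at h
              omega)
    have hinj : Set.InjOn (fun j => ({{i, j}} : Coll n)) (Finset.univ.erase i : Finset (Fin n)) := by
      intro j hj k hk hjk
      have h1 : ({i, j} : Finset (Fin n)) = {i, k} := Finset.singleton_injective hjk
      have h2 : j ∈ ({i, k} : Finset (Fin n)) := by rw [← h1]; simp
      simp only [Finset.mem_insert, Finset.mem_singleton] at h2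
      exact h2.resolve_left (Finset.ne_of_mem_erase hj)
    rw [Finset.sum_insert, Finset.sum_insert, Finset.sum_image hinj,
      Finset.sum_congr rfl (fun j hj => f_two _ (hpair j hj)), f_empty, Finset.sum_const,
      Finset.card_erase_of_mem (Finset.mem_univ _), Finset.card_univ, Fintype.card_fin,
      nsmul_eq_mul, Nat.cast_sub (by omega)] at this
    · push_cast at this
      linarith
    · simp only [Finset.mem_image, not_exists, not_and]
      intro j hj h
      have := hpair j hj
      rw [Finset.singleton_injective h] at this
      simp at this
    · simp
  have f_disjoint : ∀ T ∈ disjointPairs n, f T = 1 := by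
    intro T hT
    simp only [disjointPairs, Finset.mem_filter, Finset.mem_univ, true_and] at hT
    obtain ⟨X, Y, hX, hY, hXY, rfl⟩ := hT
    have hne := Finset.ne_of_disjoint_of_card_eq_two hX hXY
    have := lower ⟨{X, Y}, memL_pair_s17 hX hY hXY⟩ {∅, {X}, {Y}, {X, Y}} (by simp)
      (by
        simp only [Finset.mem_insert, Finset.mem_singleton]
        rintro T (rfl | rfl | rfl | rfl)
        exacts [(Lbot n 2).mem, (singL n 2 X hX.le).mem, (singL n 2 Y hY.le).mem,
          memL_pair_s17 hX hY hXY])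
      (by
        intro T hT
        simp only [Finset.mem_insert, Finset.mem_singleton]
        constructor
        · rintro (rfl | rfl | rfl | rfl)
          · right; simp [rho_empty, rho_pair hne, codim, hX, hY]
          · right; simp [rho_singleton, rho_pair hne, codim, hX, hY]
          · right; simp [rho_singleton, rho_pair hne, codim, hX, hY]
          · exact Or.inl rfl
        · rintro (h | ⟨h, hsub⟩)
          · exact Or.inr (Or.inr (Or.inr h))
          · rw [rho_pair hne] at h
            rcases memL_two_iff.mp hT with rfl | ⟨Z, hZ, rfl⟩ | ⟨Z, W, hZ, hW, hZW, rfl⟩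
            · exact Or.inl rfl
            · simp only [rho_singleton, codim, hX, hY] at h
              obtain ⟨V, hV, hVZ⟩ := hsub Z (by simp)
              rcases hV with rfl | rfl
              · right; left
                rw [Finset.eq_of_subset_of_card_le hVZ (by omega)]
              · right; right; left
                rw [Finset.eq_of_subset_of_card_le hVZ (by omega)]
            · rw [rho_pair (Finset.ne_of_disjoint_of_card_eq_two hZ hZW)] at h
              simp only [codim, hX, hY, hZ, hW] at h
              omega)
    have hXT : ({X} : Coll n) ≠ {X, Y} := fun h => by
      have := congrArg Finset.card h
      rw [Finset.card_pair hne] at this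
      simp at this
    have hYT : ({Y} : Coll n) ≠ {X, Y} := fun h => by
      have := congrArg Finset.card h
      rw [Finset.card_pair hne] at this
      simp at this
    rw [Finset.sum_insert (by simp [(Finset.insert_ne_empty _ _).symm]), Finset.sum_insert (by simp [hne, hXT]),
      Finset.sum_pair hYT, f_empty, f_two X hX, f_two Y hY] at this
    linarith
  have htop : μ (Lbot n 2) (Ltop n 2) = f {∅} := (extendZero_val _ (Ltop n 2)).symm
  set P : Finset (Coll n) :=
    (Finset.powersetCard 2 (Finset.univ : Finset (Fin n))).image fun X => {X} with hP
  set Q : Finset (Coll n) := (Finset.univ : Finset (Fin n)).image fun i => {{i}} with hQ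
  have memP : ∀ T, T ∈ P ↔ ∃ X : Finset (Fin n), X.card = 2 ∧ {X} = T := by
    simp [hP, Finset.mem_powersetCard]
  have memQ : ∀ T, T ∈ Q ↔ ∃ i : Fin n, {{i}} = T := by simp [hQ]
  have memD : ∀ T ∈ disjointPairs n, T.card = 2 ∧ memL n 2 T ∧ rho 2 T = 2 := by
    intro T hT
    simp only [disjointPairs, Finset.mem_filter, Finset.mem_univ, true_and] at hT
    obtain ⟨X, Y, hX, hY, hXY, rfl⟩ := hT
    have hne := Finset.ne_of_disjoint_of_card_eq_two hX hXY
    exact ⟨Finset.card_pair hne, memL_pair_s17 hX hY hXY, by simp [rho_pair hne, codim, hX, hY]⟩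
  have hPQ : Disjoint P Q := by
    rw [Finset.disjoint_left]
    intro T h1 h2
    obtain ⟨X, hX, rfl⟩ := (memP _).mp h1
    obtain ⟨i, hi⟩ := (memQ _).mp h2
    rw [← Finset.singleton_injective hi] at hX
    simp at hX
  have hPQD : Disjoint (P ∪ Q) (disjointPairs n) := by
    rw [Finset.disjoint_left]
    intro T h1 h2
    have := (memD T h2).1
    rcases Finset.mem_union.mp h1 with h | h
    · obtain ⟨X, -, rfl⟩ := (memP _).mp h
      simp at this
    · obtain ⟨i, rfl⟩ := (memQ _).mp h
      simp at this
  have total := lower (Ltop n 2) (insert ∅ (insert {∅} (P ∪ Q ∪ disjointPairs n)))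
    (by simp [Ltop])
    (by
      simp only [Finset.mem_insert, Finset.mem_union]
      rintro T (rfl | rfl | (h | h) | h)
      · exact (Lbot n 2).mem
      · exact (Ltop n 2).mem
      · obtain ⟨X, hX, rfl⟩ := (memP _).mp h
        exact (singL n 2 X hX.le).mem
      · obtain ⟨i, rfl⟩ := (memQ _).mp h
        exact (singL n 2 {i} (by simp)).mem
      · exact (memD T h).2.1)
    (by
      intro T hT
      simp only [Finset.mem_insert, Finset.mem_union, Ltop]
      constructor
      · rintro (rfl | rfl | (h | h) | h)
        · right; simp [rho_empty, rho_singleton, codim]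
        · exact Or.inl rfl
        · obtain ⟨X, hX, rfl⟩ := (memP _).mp h
          right; simp [rho_singleton, codim, hX]
        · obtain ⟨i, rfl⟩ := (memQ _).mp h
          right; simp [rho_singleton, codim]
        · right; simp [(memD T h).2.2, rho_singleton, codim]
      · intro _
        rcases memL_two_iff.mp hT with rfl | ⟨X, hX, rfl⟩ | h
        · exact Or.inl rfl
        · have hcases : X.card = 0 ∨ X.card = 1 ∨ X.card = 2 := by omega
          rcases hcases with h | h | h
          · rw [Finset.card_eq_zero.mp h]
            exact Or.inr (Or.inl rfl)
          · obtain ⟨i, rfl⟩ := Finset.card_eq_one.mp h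
            exact Or.inr (Or.inr (Or.inl (Or.inr ((memQ _).mpr ⟨i, rfl⟩))))
          · exact Or.inr (Or.inr (Or.inl (Or.inl ((memP _).mpr ⟨X, h, rfl⟩))))
        · exact Or.inr (Or.inr (Or.inr (by simpa [disjointPairs] using h))))
  have hTop : ({∅} : Coll n) ∉ P ∪ Q ∪ disjointPairs n := by
    intro h
    simp only [Finset.mem_union] at h
    rcases h with (h | h) | h
    · obtain ⟨X, hX, h⟩ := (memP _).mp h
      rw [Finset.singleton_injective h] at hX
      simp at hX
    · obtain ⟨i, h⟩ := (memQ _).mp h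
      exact Finset.singleton_ne_empty i (Finset.singleton_injective h)
    · simpa using (memD _ h).1
  have hBot : (∅ : Coll n) ∉ insert {∅} (P ∪ Q ∪ disjointPairs n) := by
    intro h
    simp only [Finset.mem_insert, Finset.mem_union] at h
    rcases h with h | (h | h) | h
    · exact Finset.singleton_ne_empty _ h.symm
    · obtain ⟨X, -, h⟩ := (memP _).mp h
      exact Finset.singleton_ne_empty _ h
    · obtain ⟨i, h⟩ := (memQ _).mp h
      exact Finset.singleton_ne_empty _ h
    · simpa using (memD _ h).1
  have sumP : ∑ T ∈ P, f T = -(n.choose 2 : ℤ) := by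
    rw [hP, Finset.sum_image Finset.singleton_injective.injOn,
      Finset.sum_congr rfl (fun X hX => f_two X (Finset.mem_powersetCard.mp hX).2)]
    simp
  have sumQ : ∑ T ∈ Q, f T = n * (n - 2 : ℤ) := by
    rw [hQ, Finset.sum_image (fun i _ j _ h =>
      Finset.singleton_injective (Finset.singleton_injective h)),
      Finset.sum_congr rfl (fun i _ => f_one i), Finset.sum_const]
    simp
  have sumD : ∑ T ∈ disjointPairs n, f T = 3 * (n.choose 4 : ℤ) := by
    rw [Finset.sum_congr rfl f_disjoint]
    simp [card_disjointPairs]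
  rw [Finset.sum_insert hBot, Finset.sum_insert hTop, Finset.sum_union hPQD,
    Finset.sum_union hPQ, f_empty, sumP, sumQ, sumD] at total
  have hchoose : (n.choose 2 : ℤ) * 2 = n * (n - 1) := by
    have h3 : n * (n - 1) = n.choose 2 * 2 := by
      rw [Nat.choose_two_right, Nat.div_mul_cancel (Nat.even_mul_pred_self n).two_dvd]
    zify [show 1 ≤ n by omega] at h3
    exact h3.symm
  rw [htop]
  linarith
end
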